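/- Let X be a GC_5 set of 21 nodes with no maximal line, and suppose a line ℓ̃ is used by five distinct nodes of X. Then ℓ̃ is a 5-node line, it is used by exactly six nodes of X, these six nodes form a GC_2 set, they share two further common used lines with five primary nodes each, and each of these six nodes has m-d sequence (5,5,5,3,2). -/

import Mathlib

open MvPolynomial

/-- Evaluation of a bivariate polynomial at a point of the real plane. -/
noncomputable def ev (p : MvPolynomial (Fin 2) ℝ) (A : ℝ × ℝ) : ℝ :=
  MvPolynomial.eval ![A.1, A.2] p

/-- A polynomial of total degree exactly 1, defining a line. -/
def IsLinePoly (l : MvPolynomial (Fin 2) ℝ) : Prop := l.totalDegree = 1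

/-- The line (zero set) defined by a polynomial. -/
def lineSet (l : MvPolynomial (Fin 2) ℝ) : Set (ℝ × ℝ) := {A | ev l A = 0}

/-- The number of nodes of `X` lying on the line defined by `l`. -/
noncomputable def nodesOn (X : Set (ℝ × ℝ)) (l : MvPolynomial (Fin 2) ℝ) : ℕ :=
  (X ∩ lineSet l).ncard

/-- `X` is an `n`-poised set: it has `N = (n+2)(n+1)/2` nodes and the only polynomial of
degree ≤ n vanishing on all of `X` is the zero polynomial. -/
def Poised (n : ℕ) (X : Set (ℝ × ℝ)) : Prop :=
  X.Finite ∧ X.ncard = (n + 2) * (n + 1) / 2 ∧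
    ∀ p : MvPolynomial (Fin 2) ℝ, p.totalDegree ≤ n → (∀ A ∈ X, ev p A = 0) → p = 0

/-- `p` is an `n`-fundamental polynomial of the node `A` with respect to `X`. -/
def IsFund (n : ℕ) (X : Set (ℝ × ℝ)) (A : ℝ × ℝ) (p : MvPolynomial (Fin 2) ℝ) : Prop :=
  p.totalDegree ≤ n ∧ ev p A = 1 ∧ ∀ B ∈ X, B ≠ A → ev p B = 0

/-- `X` is a `GC_n` set: it is `n`-poised and each fundamental polynomial is a product of
`n` linear (degree-1) polynomials. -/
def GCSet (n : ℕ) (X : Set (ℝ × ℝ)) : Prop :=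
  Poised n X ∧ ∀ A ∈ X, ∃ p : MvPolynomial (Fin 2) ℝ, IsFund n X A p ∧
    ∃ f : Fin n → MvPolynomial (Fin 2) ℝ, (∀ i, IsLinePoly (f i)) ∧ p = ∏ i, f i

/-- The node `A` uses the line `l`: the linear polynomial `l` divides a fundamental
polynomial of `A`. -/
def Uses (n : ℕ) (X : Set (ℝ × ℝ)) (A : ℝ × ℝ) (l : MvPolynomial (Fin 2) ℝ) : Prop :=
  ∃ p, IsFund n X A p ∧ l ∣ p

/-- `X` has no maximal line, i.e. no line passes through `n+1` nodes of `X`. -/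
def NoMaximalLine (n : ℕ) (X : Set (ℝ × ℝ)) : Prop :=
  ∀ l : MvPolynomial (Fin 2) ℝ, IsLinePoly l → nodesOn X l ≠ n + 1

/-- Number of nodes of `X` on the line `l` which do not lie on any of the lines
`L 0, …, L (s-1)` (the primary node count of `l` at step `s`). -/
noncomputable def resCount (X : Set (ℝ × ℝ)) (L : Fin 5 → MvPolynomial (Fin 2) ℝ)
    (s : Fin 5) (l : MvPolynomial (Fin 2) ℝ) : ℕ :=
  {B ∈ X | ev l B = 0 ∧ ∀ i : Fin 5, i < s → ev (L i) B ≠ 0}.ncard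

/-- `L` is an m-line sequence of the node `A` of the `GC_5` set `X`: it enumerates the five
distinct used lines of `A` (a fundamental polynomial of `A` is, up to a constant, the
product of the `L i`), ordered greedily: at each step `s` the line `L s` has maximal
primary node count among the remaining used lines. -/
def MLineSeq (X : Set (ℝ × ℝ)) (A : ℝ × ℝ) (L : Fin 5 → MvPolynomial (Fin 2) ℝ) : Prop :=
  (∀ i, IsLinePoly (L i)) ∧
  (∀ i j : Fin 5, i ≠ j → lineSet (L i) ≠ lineSet (L j)) ∧
  (∃ p : MvPolynomial (Fin 2) ℝ, IsFund 5 X A p ∧ ∃ c : ℝ, p = MvPolynomial.C c * ∏ i, L i) ∧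
  (∀ s t : Fin 5, s ≤ t → resCount X L s (L t) ≤ resCount X L s (L s))

/-- The node `A` has m-distribution sequence `k`. -/
def HasMDSeq (X : Set (ℝ × ℝ)) (A : ℝ × ℝ) (k : Fin 5 → ℕ) : Prop :=
  ∃ L : Fin 5 → MvPolynomial (Fin 2) ℝ, MLineSeq X A L ∧ ∀ s, resCount X L s (L s) = k s

/-! ### Lines and divisibility -/

lemma ev_mul (p q : MvPolynomial (Fin 2) ℝ) (A : ℝ × ℝ) : ev (p * q) A = ev p A * ev q A := by
  simp [ev]

lemma ev_C (c : ℝ) (A : ℝ × ℝ) : ev (C c) A = c := by simp [ev]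

lemma ev_prod {ι : Type*} (s : Finset ι) (f : ι → MvPolynomial (Fin 2) ℝ) (A : ℝ × ℝ) :
    ev (∏ i ∈ s, f i) A = ∏ i ∈ s, ev (f i) A := by
  simp [ev, map_prod]

lemma ev_sum {ι : Type*} (s : Finset ι) (f : ι → MvPolynomial (Fin 2) ℝ) (A : ℝ × ℝ) :
    ev (∑ i ∈ s, f i) A = ∑ i ∈ s, ev (f i) A := by
  simp [ev, map_sum]

lemma IsLinePoly.ne_zero {l : MvPolynomial (Fin 2) ℝ} (hl : IsLinePoly l) : l ≠ 0 := by
  rintro rfl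
  simp [IsLinePoly] at hl

lemma IsLinePoly.exists_coeffs {l : MvPolynomial (Fin 2) ℝ} (hl : IsLinePoly l) :
    ∃ a b c : ℝ, (a ≠ 0 ∨ b ≠ 0) ∧ l = C a * X 0 + C b * X 1 + C c := by
  have hform : l = C (coeff (Finsupp.single 0 1) l) * X 0 + C (coeff (Finsupp.single 1 1) l) * X 1
      + C (coeff 0 l) := by
    ext m
    simp only [coeff_add, coeff_C_mul, coeff_X, coeff_C]
    by_cases h0 : m = 0
    · subst h0
      simp [Finsupp.single_eq_zero]
    by_cases h1 : Finsupp.single 0 1 = m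
    · subst h1
      simp [Finsupp.single_left_inj, Ne.symm h0]
    by_cases h2 : Finsupp.single 1 1 = m
    · subst h2
      simp [Finsupp.single_left_inj, Ne.symm h0]
    simp only [h1, h2, Ne.symm h0, if_false]
    simp only [mul_zero, add_zero]
    apply coeff_eq_zero_of_totalDegree_lt
    rw [hl]
    have hsum : ∑ i ∈ m.support, m i = m 0 + m 1 := by
      have := Finsupp.sum_fintype m (fun _ a => a) (by simp)
      rw [Finsupp.sum, Fin.sum_univ_two] at this
      exact this
    rw [hsum]
    by_contra hle
    have : (m 0 = 0 ∧ m 1 = 0) ∨ (m 0 = 1 ∧ m 1 = 0) ∨ (m 0 = 0 ∧ m 1 = 1) := by omega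
    rcases this with ⟨e0, e1⟩ | ⟨e0, e1⟩ | ⟨e0, e1⟩
    · exact h0 (by ext i; fin_cases i <;> simp [e0, e1])
    · exact h1 (by ext i; fin_cases i <;> simp [e0, e1])
    · exact h2 (by ext i; fin_cases i <;> simp [e0, e1])
  refine ⟨_, _, _, ?_, hform⟩
  by_contra! h
  rw [h.1, h.2] at hform
  have : l.totalDegree = 0 := by
    rw [hform]
    simp
  rw [hl] at this
  exact one_ne_zero this

/-- A line has an affine parametrization whose fibres are divisible by its equation. -/
lemma IsLinePoly.exists_param {l : MvPolynomial (Fin 2) ℝ} (hl : IsLinePoly l) :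
    ∃ γ : ℝ → ℝ × ℝ, Function.Injective γ ∧ (∀ A, ev l A = 0 ↔ ∃ t, γ t = A) ∧
      ∃ φ : MvPolynomial (Fin 2) ℝ →ₐ[ℝ] Polynomial ℝ,
        (∀ f t, (φ f).eval t = ev f (γ t)) ∧ (∀ f, (φ f).natDegree ≤ f.totalDegree) ∧
        ∀ f, φ f = 0 → l ∣ f := by
  obtain ⟨a, b, c, hab, rfl⟩ := hl.exists_coeffs
  have hN : a ^ 2 + b ^ 2 ≠ 0 := by
    rcases hab with h | h <;> positivity
  set N := a ^ 2 + b ^ 2 with hNdef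
  set γ : ℝ → ℝ × ℝ := fun t => (-(a * c / N) + b * t, -(b * c / N) - a * t) with hγ
  set g : Fin 2 → Polynomial ℝ :=
    ![Polynomial.C (-(a * c / N)) + Polynomial.C b * Polynomial.X,
      Polynomial.C (-(b * c / N)) - Polynomial.C a * Polynomial.X] with hg
  refine ⟨γ, ?_, ?_, aeval g, ?_, ?_, ?_⟩
  · intro s t hst
    simp only [hγ, Prod.mk.injEq] at hst
    rcases hab with h | h
    · exact mul_left_cancel₀ h (by linarith [hst.2])
    · exact mul_left_cancel₀ h (by linarith [hst.1])
  · rintro ⟨x, y⟩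
    simp only [ev, hγ]
    simp
    constructor
    · intro h
      have hc : c = -(a * x + b * y) := by linarith
      refine ⟨(b * x - a * y) / N, ?_, ?_⟩ <;> rw [hc] <;> field_simp <;> rw [hNdef] <;> ring
    · rintro ⟨t, rfl, rfl⟩
      field_simp
      rw [hNdef]; ring
  · intro f t
    have : ((Polynomial.aeval t).comp (aeval g)) = aeval ![(γ t).1, (γ t).2] := by
      apply MvPolynomial.algHom_ext
      intro i
      fin_cases i <;> simp [hg, hγ]
    have h2 := DFunLike.congr_fun this f
    simpa [ev, Polynomial.coe_aeval_eq_eval, MvPolynomial.aeval_eq_eval] using h2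
  · intro f
    refine (MvPolynomial.aeval_natDegree_le f le_rfl g (n := 1) fun i => ?_).trans_eq (mul_one _)
    fin_cases i <;> simp only [hg] <;> simp <;> compute_degree
  · intro f hf
    set l : MvPolynomial (Fin 2) ℝ := C a * X 0 + C b * X 1 + C c with hldef
    set ψ : Polynomial ℝ →ₐ[ℝ] MvPolynomial (Fin 2) ℝ :=
      Polynomial.aeval (C (b / N) * X 0 - C (a / N) * X 1) with hψ
    have key : ((Ideal.Quotient.mkₐ ℝ (Ideal.span {l})).comp (ψ.comp (aeval g))) =
        Ideal.Quotient.mkₐ ℝ (Ideal.span {l}) := by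
      apply MvPolynomial.algHom_ext
      intro i
      simp only [AlgHom.comp_apply, Ideal.Quotient.mkₐ_eq_mk]
      rw [Ideal.Quotient.eq, Ideal.mem_span_singleton]
      have e1 : a / N * a + b / N * b = 1 := by field_simp; rw [hNdef]
      have hx : (C (a / N) * C a + C (b / N) * C b : MvPolynomial (Fin 2) ℝ) = 1 := by
        rw [← C_mul, ← C_mul, ← C_add, e1, C_1]
      have hxb : (C b * C (a / N) : MvPolynomial (Fin 2) ℝ) = C a * C (b / N) := by
        rw [← C_mul, ← C_mul]; congr 1; ring
      fin_cases i
      · refine ⟨- C (a / N), ?_⟩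
        have : -(a * c / N) = - (a / N * c) := by ring
        simp [hg, hψ, this, hldef, MvPolynomial.algebraMap_eq]
        linear_combination (X 0) * hx
      · refine ⟨- C (b / N), ?_⟩
        have : -(b * c / N) = - (b / N * c) := by ring
        simp [hg, hψ, this, hldef, MvPolynomial.algebraMap_eq]
        linear_combination (X 1) * hx
    have h2 := DFunLike.congr_fun key f
    simp only [AlgHom.comp_apply, hf, map_zero, Ideal.Quotient.mkₐ_eq_mk] at h2
    exact Ideal.mem_span_singleton.1 (Ideal.Quotient.eq_zero_iff_mem.1 h2.symm)

lemma IsLinePoly.dvd_of_vanish {l f : MvPolynomial (Fin 2) ℝ} (hl : IsLinePoly l)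
    (T : Finset (ℝ × ℝ)) (hT : ∀ P ∈ T, ev l P = 0) (hf : ∀ P ∈ T, ev f P = 0)
    (hcard : f.totalDegree < T.card) : l ∣ f := by
  obtain ⟨γ, hγ, hγl, φ, hφ, hdeg, hdvd⟩ := hl.exists_param
  apply hdvd
  choose! τ hτ using fun P hP => (hγl P).1 (hT P hP)
  refine Polynomial.eq_zero_of_natDegree_lt_card_of_eval_eq_zero' (φ f) (T.image τ) ?_ ?_
  · intro t ht
    obtain ⟨P, hP, rfl⟩ := Finset.mem_image.1 ht
    rw [hφ, hτ P hP, hf P hP]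
  · rw [Finset.card_image_of_injOn]
    · exact (hdeg f).trans_lt hcard
    · intro P hP Q hQ h
      rw [← hτ P hP, ← hτ Q hQ]
      exact congrArg γ h

lemma IsLinePoly.infinite {l : MvPolynomial (Fin 2) ℝ} (hl : IsLinePoly l) :
    (lineSet l).Infinite := by
  obtain ⟨γ, hγ, hγl, -⟩ := hl.exists_param
  have : lineSet l = Set.range γ := by
    ext A; simp [lineSet, hγl]
  rw [this]
  exact Set.infinite_range_of_injective hγ

lemma ev_eq_zero_of_dvd {l f : MvPolynomial (Fin 2) ℝ} (h : l ∣ f) {P : ℝ × ℝ}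
    (hP : ev l P = 0) : ev f P = 0 := by
  obtain ⟨g, rfl⟩ := h
  rw [ev_mul, hP, zero_mul]

lemma IsLinePoly.prime {l : MvPolynomial (Fin 2) ℝ} (hl : IsLinePoly l) : Prime l := by
  apply Irreducible.prime
  apply irreducible_of_totalDegree_eq_one hl
  intro x hx
  obtain ⟨a, b, c, hab, rfl⟩ := hl.exists_coeffs
  rw [isUnit_iff_ne_zero]
  rintro rfl
  apply hl.ne_zero
  ext m
  simpa using hx m

lemma IsLinePoly.eq_C_mul_of_dvd {l m : MvPolynomial (Fin 2) ℝ} (hl : IsLinePoly l)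
    (hm : IsLinePoly m) (h : l ∣ m) : ∃ c : ℝ, c ≠ 0 ∧ m = C c * l := by
  obtain ⟨g, rfl⟩ := h
  have hg : g ≠ 0 := right_ne_zero_of_mul hm.ne_zero
  have h1 : l.totalDegree + g.totalDegree = 1 := by
    rw [← totalDegree_mul_of_isDomain hl.ne_zero hg]; exact hm
  rw [hl] at h1
  rw [totalDegree_eq_zero_iff_eq_C.1 (by omega : g.totalDegree = 0)] at hg ⊢
  exact ⟨_, fun h => hg (by rw [h, C_0]), mul_comm _ _⟩

lemma lineSet_C_mul {c : ℝ} (hc : c ≠ 0) (l : MvPolynomial (Fin 2) ℝ) :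
    lineSet (C c * l) = lineSet l := by
  ext A
  simp [lineSet, ev_mul, ev_C, hc]

/-- A line equation can be cancelled from a product of line equations. -/
lemma exists_prod_of_mul_eq_prod {n : ℕ} {l g : MvPolynomial (Fin 2) ℝ} (hl : IsLinePoly l)
    {c : ℝ} (hc : c ≠ 0) {f : Fin (n + 1) → MvPolynomial (Fin 2) ℝ} (hf : ∀ i, IsLinePoly (f i))
    (h : l * g = C c * ∏ i, f i) :
    ∃ c' : ℝ, c' ≠ 0 ∧ ∃ f' : Fin n → MvPolynomial (Fin 2) ℝ, (∀ i, IsLinePoly (f' i)) ∧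
      g = C c' * ∏ i, f' i := by
  have hdvd : l ∣ C c * ∏ i, f i := ⟨g, h.symm⟩
  rcases hl.prime.dvd_or_dvd hdvd with h1 | h1
  · exfalso
    obtain ⟨P, hP⟩ := hl.infinite.nonempty
    have := ev_eq_zero_of_dvd h1 hP
    rw [ev_C] at this
    exact hc this
  · obtain ⟨j, -, hj⟩ := (Prime.dvd_finsetProd_iff hl.prime _).1 h1
    obtain ⟨d, hd, hfj⟩ := hl.eq_C_mul_of_dvd (hf j) hj
    refine ⟨c * d, mul_ne_zero hc hd, fun i => f (j.succAbove i), fun i => hf _, ?_⟩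
    apply mul_left_cancel₀ hl.ne_zero
    rw [h, Fin.prod_univ_succAbove f j, hfj, C_mul]
    ring

/-- A polynomial of degree at most `n` vanishing at enough points of `n` lines, counted
successively, is a multiple of the product of these lines. -/
lemma eq_C_mul_prod_of_vanish {n : ℕ} (r : Fin n → MvPolynomial (Fin 2) ℝ)
    (hr : ∀ i, IsLinePoly (r i)) (T : Fin n → Finset (ℝ × ℝ))
    (hT : ∀ i, ∀ P ∈ T i, ev (r i) P = 0) (hoff : ∀ i j, j < i → ∀ P ∈ T i, ev (r j) P ≠ 0)
    (hcard : ∀ i, n + 1 ≤ (T i).card + i) (f : MvPolynomial (Fin 2) ℝ) (hdeg : f.totalDegree ≤ n)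
    (hf : ∀ i, ∀ P ∈ T i, ev f P = 0) : ∃ c : ℝ, f = C c * ∏ i, r i := by
  induction n generalizing f with
  | zero => exact ⟨coeff 0 f, by simpa using totalDegree_eq_zero_iff_eq_C.1 (by omega)⟩
  | succ n ih =>
    obtain ⟨g, rfl⟩ : r 0 ∣ f := by
      apply (hr 0).dvd_of_vanish (T 0) (hT 0) (hf 0)
      have := hcard 0
      simp only [Fin.val_zero] at this
      omega
    by_cases hg : g = 0
    · exact ⟨0, by simp [hg]⟩
    rw [totalDegree_mul_of_isDomain (hr 0).ne_zero hg, hr 0] at hdeg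
    obtain ⟨c, hc⟩ := ih (fun i => r i.succ) (fun i => hr _) (fun i => T i.succ) (fun i => hT _)
      (fun i j hij => hoff _ _ (Fin.succ_lt_succ_iff.2 hij))
      (fun i => by have := hcard i.succ; simp only [Fin.val_succ] at this; omega) g (by omega)
      (fun i P hP => by
        have := hf _ P hP
        rw [ev_mul] at this
        exact (mul_eq_zero.1 this).resolve_left (hoff _ _ (Fin.succ_pos i) P hP))
    refine ⟨c, ?_⟩
    rw [hc, Fin.prod_univ_succ]
    ring

/-! ### Lines as point sets -/

/-- A set of points is a line if it is the zero set of a polynomial of degree one. -/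
def IsLine (s : Set (ℝ × ℝ)) : Prop := ∃ l, IsLinePoly l ∧ lineSet l = s

/-- A chosen equation of a line. -/
noncomputable def linePoly (s : Set (ℝ × ℝ)) : MvPolynomial (Fin 2) ℝ :=
  Classical.epsilon fun l => IsLinePoly l ∧ lineSet l = s

lemma IsLine.isLinePoly {s : Set (ℝ × ℝ)} (hs : IsLine s) : IsLinePoly (linePoly s) :=
  (Classical.epsilon_spec hs).1

lemma IsLine.lineSet_linePoly {s : Set (ℝ × ℝ)} (hs : IsLine s) : lineSet (linePoly s) = s :=
  (Classical.epsilon_spec hs).2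

lemma IsLine.ev_linePoly {s : Set (ℝ × ℝ)} (hs : IsLine s) (P : ℝ × ℝ) :
    ev (linePoly s) P = 0 ↔ P ∈ s := by
  conv_rhs => rw [← hs.lineSet_linePoly]
  rfl

lemma IsLinePoly.isLine {l : MvPolynomial (Fin 2) ℝ} (hl : IsLinePoly l) : IsLine (lineSet l) :=
  ⟨l, hl, rfl⟩

lemma IsLine.infinite {s : Set (ℝ × ℝ)} (hs : IsLine s) : s.Infinite := by
  rw [← hs.lineSet_linePoly]
  exact hs.isLinePoly.infinite

lemma IsLine.eq_of_mem {s t : Set (ℝ × ℝ)} (hs : IsLine s) (ht : IsLine t) {P Q : ℝ × ℝ}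
    (hPQ : P ≠ Q) (hPs : P ∈ s) (hQs : Q ∈ s) (hPt : P ∈ t) (hQt : Q ∈ t) : s = t := by
  classical
  have hdvd : linePoly s ∣ linePoly t := by
    apply hs.isLinePoly.dvd_of_vanish {P, Q}
    · simp [hs.ev_linePoly, hPs, hQs]
    · simp [ht.ev_linePoly, hPt, hQt]
    · rw [Finset.card_pair hPQ, ht.isLinePoly]
      norm_num
  obtain ⟨c, hc, h⟩ := hs.isLinePoly.eq_C_mul_of_dvd ht.isLinePoly hdvd
  rw [← hs.lineSet_linePoly, ← ht.lineSet_linePoly, h, lineSet_C_mul hc]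

lemma isLinePoly_of_coeffs {a b c : ℝ} (hab : a ≠ 0 ∨ b ≠ 0) :
    IsLinePoly (C a * X 0 + C b * X 1 + C c) := by
  apply le_antisymm
  · have hX (d : ℝ) (i : Fin 2) : (C d * X i : MvPolynomial (Fin 2) ℝ).totalDegree ≤ 1 :=
      (totalDegree_mul _ _).trans (by simp)
    refine (totalDegree_add _ _).trans (max_le ((totalDegree_add _ _).trans ?_) (by simp))
    exact max_le (hX _ _) (hX _ _)
  · by_contra! h
    rw [Nat.lt_one_iff, totalDegree_eq_zero_iff_eq_C] at h
    have h0 := congrArg (coeff (Finsupp.single 0 1)) h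
    have h1 := congrArg (coeff (Finsupp.single 1 1)) h
    simp [coeff_C_mul, coeff_X, coeff_C, Finsupp.single_left_inj] at h0 h1
    tauto

lemma exists_line_through (P Q : ℝ × ℝ) : ∃ s, IsLine s ∧ P ∈ s ∧ Q ∈ s := by
  wlog hPQ : P ≠ Q generalizing Q
  · obtain ⟨s, hs, hP, -⟩ := this (P.1 + 1, P.2) (fun h => by simpa using congrArg Prod.fst h)
    rw [not_not] at hPQ
    exact ⟨s, hs, hP, hPQ ▸ hP⟩
  refine ⟨_, (isLinePoly_of_coeffs (a := Q.2 - P.2) (b := P.1 - Q.1)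
    (c := P.2 * Q.1 - P.1 * Q.2) ?_).isLine, ?_, ?_⟩
  · by_contra! h
    exact hPQ (Prod.ext (by linarith [h.2]) (by linarith [h.1]))
  · simp [lineSet, ev]; ring
  · simp [lineSet, ev]; ring

/-- The product of the equations of finitely many lines. -/
noncomputable def linesPoly (S : Finset (Set (ℝ × ℝ))) : MvPolynomial (Fin 2) ℝ :=
  ∏ s ∈ S, linePoly s

lemma ev_linesPoly {S : Finset (Set (ℝ × ℝ))} (hS : ∀ s ∈ S, IsLine s) (P : ℝ × ℝ) :
    ev (linesPoly S) P = 0 ↔ ∃ s ∈ S, P ∈ s := by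
  rw [linesPoly, ev_prod, Finset.prod_eq_zero_iff]
  exact exists_congr fun s => and_congr_right fun hs => (hS s hs).ev_linePoly P

lemma linesPoly_ne_zero {S : Finset (Set (ℝ × ℝ))} (hS : ∀ s ∈ S, IsLine s) :
    linesPoly S ≠ 0 :=
  Finset.prod_ne_zero_iff.2 fun s hs => (hS s hs).isLinePoly.ne_zero

lemma totalDegree_linesPoly_le {S : Finset (Set (ℝ × ℝ))} (hS : ∀ s ∈ S, IsLine s) :
    (linesPoly S).totalDegree ≤ S.card := by
  refine (totalDegree_finsetProd _ _).trans ?_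
  rw [Finset.sum_congr rfl fun s hs => (hS s hs).isLinePoly]
  simp

/-- An `n`-poised set is not covered by `n` lines. -/
lemma Poised.exists_notMem_lines {n : ℕ} {X : Set (ℝ × ℝ)} (hX : Poised n X)
    (S : Finset (Set (ℝ × ℝ))) (hS : ∀ s ∈ S, IsLine s) (hcard : S.card ≤ n) :
    ∃ P ∈ X, ∀ s ∈ S, P ∉ s := by
  by_contra! h
  exact linesPoly_ne_zero hS (hX.2.2 _ ((totalDegree_linesPoly_le hS).trans hcard)
    fun A hA => (ev_linesPoly hS A).2 (h A hA))

/-- `S` is a set of four lines which together with `l` cover all nodes except `A`, and none of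
these five lines passes through `A`. -/
structure IsStar (X : Finset (ℝ × ℝ)) (l : Set (ℝ × ℝ)) (A : ℝ × ℝ)
    (S : Finset (Set (ℝ × ℝ))) : Prop where
  mem : A ∈ X
  card : S.card = 4
  isLine : ∀ s ∈ S, IsLine s
  notMem : l ∉ S
  notMem_base : A ∉ l
  notMem_line : ∀ s ∈ S, A ∉ s
  cover : ∀ P ∈ X, P ≠ A → P ∉ l → ∃ s ∈ S, P ∈ s

lemma IsFund.unique {n : ℕ} {X : Set (ℝ × ℝ)} (hX : Poised n X) {A : ℝ × ℝ}
    {p q : MvPolynomial (Fin 2) ℝ} (hp : IsFund n X A p) (hq : IsFund n X A q) : p = q := by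
  rw [← sub_eq_zero]
  apply hX.2.2
  · exact (totalDegree_sub _ _).trans (max_le hp.1 hq.1)
  · intro B hB
    have hsub : ev (p - q) B = ev p B - ev q B := by simp [ev]
    rw [hsub]
    by_cases h : B = A
    · rw [h, hp.2.1, hq.2.1, sub_self]
    · rw [hp.2.2 B hB h, hq.2.2 B hB h, sub_self]

/-- A used line can be split off from the fundamental polynomial of a node of a `GC` set. -/
lemma GCSet.exists_of_uses {n : ℕ} {X : Set (ℝ × ℝ)} (hX : GCSet (n + 1) X) {A : ℝ × ℝ}
    (hA : A ∈ X) {l : MvPolynomial (Fin 2) ℝ} (hl : IsLinePoly l) (h : Uses (n + 1) X A l) :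
    ∃ c : ℝ, c ≠ 0 ∧ ∃ f : Fin n → MvPolynomial (Fin 2) ℝ, (∀ i, IsLinePoly (f i)) ∧
      IsFund (n + 1) X A (l * (C c * ∏ i, f i)) := by
  obtain ⟨p, hp, g, rfl⟩ := h
  obtain ⟨q, hq, f, hf, rfl⟩ := hX.2 A hA
  obtain ⟨c, hc, f', hf', rfl⟩ := exists_prod_of_mul_eq_prod (c := 1) hl one_ne_zero hf
    (by rw [hp.unique hX.1 hq]; simp)
  exact ⟨c, hc, f', hf', hp⟩

lemma GCSet.exists_isStar {X : Finset (ℝ × ℝ)} (hX : GCSet 5 (X : Set (ℝ × ℝ))) {A : ℝ × ℝ}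
    (hA : A ∈ X) {l : MvPolynomial (Fin 2) ℝ} (hl : IsLinePoly l)
    (h : Uses 5 (X : Set (ℝ × ℝ)) A l) : ∃ S, IsStar X (lineSet l) A S := by
  classical
  obtain ⟨c, hc, f, hf, hp⟩ := hX.exists_of_uses (n := 4) (Finset.mem_coe.2 hA) hl h
  have hev (P : ℝ × ℝ) : ev (l * (C c * ∏ i, f i)) P = 0 ↔
      P ∈ lineSet l ∨ ∃ i, P ∈ lineSet (f i) := by
    simp [ev_mul, ev_C, ev_prod, hc, lineSet, Finset.prod_eq_zero_iff]
  have hAne : ¬ (A ∈ lineSet l ∨ ∃ i, A ∈ lineSet (f i)) := by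
    rw [← hev, hp.2.1]
    exact one_ne_zero
  push Not at hAne
  have hcov : ∀ P ∈ X, P ≠ A → P ∈ lineSet l ∨ ∃ i, P ∈ lineSet (f i) :=
    fun P hP hPA => (hev P).1 (hp.2.2 P hP hPA)
  set S : Finset (Set (ℝ × ℝ)) := Finset.univ.image fun i => lineSet (f i) with hS
  have hScard : S.card ≤ 4 := Finset.card_image_le
  have hSline : ∀ s ∈ S, IsLine s := by
    simp only [hS, Finset.mem_image]
    rintro s ⟨i, -, rfl⟩
    exact (hf i).isLine
  have hcard : 5 ≤ (insert (lineSet l) S).card := by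
    by_contra! hlt
    obtain ⟨t, ht, hAt, -⟩ := exists_line_through A A
    obtain ⟨P, hP, hPn⟩ := hX.1.exists_notMem_lines (insert t (insert (lineSet l) S))
      (by simp only [Finset.mem_insert]; rintro s (rfl | rfl | hs)
          exacts [ht, hl.isLine, hSline s hs])
      ((Finset.card_insert_le _ _).trans (by omega))
    simp only [Finset.mem_insert, forall_eq_or_imp] at hPn
    rcases hcov P hP (fun h => hPn.1 (h ▸ hAt)) with h1 | ⟨i, hi⟩
    · exact hPn.2.1 h1
    · exact hPn.2.2 _ (Finset.mem_image_of_mem _ (Finset.mem_univ i)) hi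
  have hnot : lineSet l ∉ S := fun hmem => by
    rw [Finset.insert_eq_of_mem hmem] at hcard
    omega
  rw [Finset.card_insert_of_notMem hnot] at hcard
  refine ⟨S, hA, by omega, hSline, hnot, hAne.1, ?_, ?_⟩
  · simp only [hS, Finset.mem_image]
    rintro s ⟨i, -, rfl⟩
    exact hAne.2 i
  · intro P hP hPA hPl
    obtain ⟨i, hi⟩ := (hcov P hP hPA).resolve_left hPl
    exact ⟨_, Finset.mem_image_of_mem _ (Finset.mem_univ i), hi⟩

open Classical in
/-- A line contains at most `n + 1` points of a `GC_n` set. -/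
lemma GCSet.card_filter_mem_le {n : ℕ} {X : Finset (ℝ × ℝ)}
    (hX : GCSet n (X : Set (ℝ × ℝ))) {s : Set (ℝ × ℝ)} (hs : IsLine s) :
    (X.filter (· ∈ s)).card ≤ n + 1 := by
  by_contra! h
  obtain ⟨A, hA⟩ := Finset.card_pos.1 (by omega : 0 < (X.filter (· ∈ s)).card)
  obtain ⟨hAX, hAs⟩ := Finset.mem_filter.1 hA
  obtain ⟨p, hp, -⟩ := hX.2 A hAX
  have hdvd : linePoly s ∣ p := by
    apply hs.isLinePoly.dvd_of_vanish ((X.filter (· ∈ s)).erase A)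
    · intro P hP
      rw [hs.ev_linePoly]
      exact (Finset.mem_filter.1 (Finset.mem_of_mem_erase hP)).2
    · intro P hP
      exact hp.2.2 P (Finset.mem_filter.1 (Finset.mem_of_mem_erase hP)).1
        (Finset.ne_of_mem_erase hP)
    · rw [Finset.card_erase_of_mem hA]
      exact hp.1.trans_lt (by omega)
  have := ev_eq_zero_of_dvd hdvd ((hs.ev_linePoly A).2 hAs)
  rw [hp.2.1] at this
  exact one_ne_zero this

section Configuration

open Classical

/-! ### Interpolation obstruction -/

/-- Consider nodes `A` and `U j` whose stars share the base line `l`. The lines of the star of `A`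
cannot contain, counted successively, `5, 4, 3, 2` nodes off `l` and different from the `U j`, even
if one node fewer is required for each `U j` except one. -/
lemma IsStar.false_of_primary_nodes {X : Finset (ℝ × ℝ)} {l : Set (ℝ × ℝ)} {A : ℝ × ℝ}
    {S : Finset (Set (ℝ × ℝ))} (hA : IsStar X l A S) {e : ℕ} (U : Fin (e + 1) → ℝ × ℝ)
    (hUinj : Function.Injective U) (hUA : ∀ j, U j ≠ A)
    (SU : Fin (e + 1) → Finset (Set (ℝ × ℝ))) (hU : ∀ j, IsStar X l (U j) (SU j))
    (r : Fin 4 → Set (ℝ × ℝ)) (hr : ∀ i, r i ∈ S) (hrinj : Function.Injective r)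
    (T : Fin 4 → Finset (ℝ × ℝ))
    (hT : ∀ i, ∀ P ∈ T i, P ∈ X ∧ P ∉ l ∧ P ∈ r i ∧ ∀ j, P ≠ U j)
    (hoff : ∀ i j, j < i → ∀ P ∈ T i, P ∉ r j) (ex : Fin 4 → ℕ) (hex : ∑ i, ex i ≤ e)
    (hcard : ∀ i, 5 ≤ (T i).card + ex i + i) : False := by
  have hrl i : IsLine (r i) := hA.isLine _ (hr i)
  have hE i : ∃ E : Finset (ℝ × ℝ), ↑E ⊆ r i \ (↑(T i) ∪ ⋃ j ∈ {j | j ≠ i}, r i ∩ r j) ∧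
      E.card = ex i := by
    apply Set.Infinite.exists_subset_card_eq
    apply (hrl i).infinite.sdiff
    apply (T i).finite_toSet.union
    apply Set.Finite.biUnion (Set.toFinite _)
    intro j hj
    apply Set.Subsingleton.finite
    intro P hP Q hQ
    by_contra hPQ
    exact hj (hrinj ((hrl i).eq_of_mem (hrl j) hPQ hP.1 hQ.1 hP.2 hQ.2)).symm
  choose E hEsub hEcard using hE
  set EE : Finset (ℝ × ℝ) := Finset.univ.biUnion E with hEE
  have hEEcard : EE.card ≤ e := by
    refine Finset.card_biUnion_le.trans ?_
    simpa only [hEcard] using hex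
  set q : Fin (e + 1) → MvPolynomial (Fin 2) ℝ := fun j => linesPoly (SU j) with hq
  have hker := (Matrix.mulVecLin
    (Matrix.of fun (P : EE) (j : Fin (e + 1)) => ev (q j) P)).ker_ne_bot_of_finrank_lt
    (by simp; omega)
  obtain ⟨v, hv, hv0⟩ := (Submodule.ne_bot_iff _).1 hker
  set f : MvPolynomial (Fin 2) ℝ := ∑ j, C (v j) * q j with hf
  have hevf P : ev f P = ∑ j, v j * ev (q j) P := by simp [hf, ev_sum, ev_mul, ev_C]
  have hfE : ∀ P ∈ EE, ev f P = 0 := by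
    intro P hP
    have := congrFun (LinearMap.mem_ker.1 hv) ⟨P, hP⟩
    rw [hevf]
    simpa [Matrix.mulVec, dotProduct, mul_comm] using this
  have hqz j P : ev (q j) P = 0 ↔ ∃ s ∈ SU j, P ∈ s := ev_linesPoly (hU j).isLine P
  have hqcov j P (hPX : P ∈ X) (hPl : P ∉ l) (hPU : P ≠ U j) : ev (q j) P = 0 :=
    (hqz j P).2 ((hU j).cover P hPX hPU hPl)
  obtain ⟨c, hc⟩ := eq_C_mul_prod_of_vanish (fun i => linePoly (r i))
    (fun i => (hrl i).isLinePoly) (fun i => T i ∪ E i)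
    (fun i P hP => by
      rw [(hrl i).ev_linePoly]
      rcases Finset.mem_union.1 hP with h | h
      · exact (hT i P h).2.2.1
      · exact (hEsub i h).1)
    (fun i j hji P hP => by
      rw [Ne, (hrl j).ev_linePoly]
      rcases Finset.mem_union.1 hP with h | h
      · exact hoff i j hji P h
      · intro hPj
        apply (hEsub i h).2
        right
        simp only [Set.mem_iUnion]
        exact ⟨j, hji.ne, (hEsub i h).1, hPj⟩)
    (fun i => by
      rw [Finset.card_union_of_disjoint, hEcard]
      · exact hcard i
      · rw [Finset.disjoint_left]
        intro P hPT hPE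
        exact (hEsub i hPE).2 (Or.inl hPT))
    f
    (by
      refine totalDegree_finsetSum_le fun j _ => ?_
      refine (totalDegree_mul _ _).trans ?_
      rw [totalDegree_C, zero_add]
      exact (totalDegree_linesPoly_le (hU j).isLine).trans (hU j).card.le)
    (fun i P hP => by
      rcases Finset.mem_union.1 hP with h | h
      · rw [hevf]
        obtain ⟨h1, h2, -, h3⟩ := hT i P h
        exact Finset.sum_eq_zero fun j _ => by rw [hqcov j P h1 h2 (h3 j), mul_zero]
      · exact hfE P (Finset.mem_biUnion.2 ⟨i, Finset.mem_univ i, h⟩))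
  apply hv0
  funext j
  have hS : ∀ s ∈ S, ∃ i, s = r i := by
    have himg : Finset.univ.image r = S := by
      apply Finset.eq_of_subset_of_card_le
      · intro s hs
        obtain ⟨i, -, rfl⟩ := Finset.mem_image.1 hs
        exact hr i
      · rw [Finset.card_image_of_injective _ hrinj, hA.card]
        simp
    intro s hs
    rw [← himg] at hs
    obtain ⟨i, -, rfl⟩ := Finset.mem_image.1 hs
    exact ⟨i, rfl⟩
  obtain ⟨s, hs, hUs⟩ := hA.cover (U j) (hU j).mem (hUA j) (hU j).notMem_base
  obtain ⟨i, rfl⟩ := hS s hs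
  have h0 : ev f (U j) = 0 := by
    rw [hc, ev_mul, ev_prod, Finset.prod_eq_zero (Finset.mem_univ i), mul_zero]
    exact ((hrl i).ev_linePoly _).2 hUs
  rw [hevf, Finset.sum_eq_single j] at h0
  · refine (mul_eq_zero.1 h0).resolve_right fun h => ?_
    obtain ⟨t, ht, hUt⟩ := (hqz j _).1 h
    exact (hU j).notMem_line t ht hUt
  · intro k _ hk
    rw [hqcov k (U j) (hU j).mem (hU j).notMem_base fun h => hk (hUinj h).symm, mul_zero]
  · simp

/-! ### Counting nodes on lines -/

lemma card_le_card_lines {Y : Finset (ℝ × ℝ)} {B : Finset (Set (ℝ × ℝ))}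
    (hB : ∀ b ∈ B, IsLine b) {r : Set (ℝ × ℝ)} (hr : IsLine r) (hrB : r ∉ B)
    (hY : ∀ P ∈ Y, P ∈ r ∧ ∃ b ∈ B, P ∈ b) : Y.card ≤ B.card := by
  choose! b hb hPb using fun P hP => (hY P hP).2
  apply Finset.card_le_card_of_injOn b hb
  intro P hP Q hQ h
  by_contra hPQ
  have hQb : Q ∈ b P := by
    rw [h]
    exact hPb Q hQ
  exact hrB (hr.eq_of_mem (hB _ (hb P hP)) hPQ (hY P hP).1 (hY Q hQ).1 (hPb P hP) hQb ▸ hb P hP)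

lemma card_le_mul_card_lines {Y : Finset (ℝ × ℝ)} {S B : Finset (Set (ℝ × ℝ))}
    (hS : ∀ s ∈ S, IsLine s) (hB : ∀ b ∈ B, IsLine b) (hSB : Disjoint S B)
    (hY : ∀ P ∈ Y, (∃ s ∈ S, P ∈ s) ∧ ∃ b ∈ B, P ∈ b) : Y.card ≤ S.card * B.card := by
  refine (Finset.card_le_card ?_).trans
    (Finset.card_biUnion_le_card_mul S (fun s => Y.filter (· ∈ s)) B.card fun s hs => ?_)
  · intro P hP
    obtain ⟨s, hs, hPs⟩ := (hY P hP).1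
    exact Finset.mem_biUnion.2 ⟨s, hs, Finset.mem_filter.2 ⟨hP, hPs⟩⟩
  · exact card_le_card_lines hB (hS s hs) (Finset.disjoint_left.1 hSB hs)
      fun P hP => ⟨(Finset.mem_filter.1 hP).2, (hY P (Finset.mem_filter.1 hP).1).2⟩

lemma card_le_card_add_card {Y Y₁ Y₂ : Finset (ℝ × ℝ)} (h : ∀ P ∈ Y, P ∈ Y₁ ∨ P ∈ Y₂) :
    Y.card ≤ Y₁.card + Y₂.card :=
  (Finset.card_le_card fun P hP => Finset.mem_union.2 (h P hP)).trans (Finset.card_union_le _ _)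

/-! ### Pairs of stars with a common base line -/

variable {X : Finset (ℝ × ℝ)} {l : Set (ℝ × ℝ)}

lemma IsStar.exists_mem_sdiff {A P : ℝ × ℝ} {S G : Finset (Set (ℝ × ℝ))} (hA : IsStar X l A S)
    (hPX : P ∈ X) (hPA : P ≠ A) (hPl : P ∉ l) (hPG : ∀ s ∈ S, s ∈ G → P ∉ s) :
    ∃ s ∈ S \ G, P ∈ s := by
  obtain ⟨s, hs, hPs⟩ := hA.cover P hPX hPA hPl
  exact ⟨s, Finset.mem_sdiff.2 ⟨hs, fun h => hPG s hs h hPs⟩, hPs⟩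

lemma IsStar.ne_of_ne {A B : ℝ × ℝ} {S S' : Finset (Set (ℝ × ℝ))} (hA : IsStar X l A S)
    (hB : IsStar X l B S') (hAB : A ≠ B) : S ≠ S' := by
  rintro rfl
  obtain ⟨s, hs, hBs⟩ := hA.cover B hB.mem hAB.symm hB.notMem_base
  exact hB.notMem_line s hs hBs

lemma IsStar.card_sdiff {A : ℝ × ℝ} {S : Finset (Set (ℝ × ℝ))} (hA : IsStar X l A S)
    (S' : Finset (Set (ℝ × ℝ))) : (S \ S').card = 4 - (S ∩ S').card := by
  have := Finset.card_sdiff_add_card_inter S S'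
  rw [hA.card] at this
  omega

/-- Two stars with exactly two common lines: these and the base line contain all but at most six
nodes. -/
lemma IsStar.exists_of_card_inter_eq_two {A B : ℝ × ℝ} {S S' : Finset (Set (ℝ × ℝ))}
    (hA : IsStar X l A S) (hB : IsStar X l B S') (h : (S ∩ S').card = 2) :
    ∃ x y, IsLine x ∧ IsLine y ∧ (X.filter fun P => P ∉ l ∧ P ∉ x ∧ P ∉ y).card ≤ 6 := by
  obtain ⟨x, y, hxy, hSS⟩ := Finset.card_eq_two.1 h
  have hx : x ∈ S ∩ S' := by simp [hSS]
  have hy : y ∈ S ∩ S' := by simp [hSS]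
  refine ⟨x, y, hA.isLine _ (Finset.mem_inter.1 hx).1, hA.isLine _ (Finset.mem_inter.1 hy).1, ?_⟩
  have hout : ∀ P, P ∉ x → P ∉ y → ∀ s ∈ S, s ∈ S' → P ∉ s := by
    intro P hPx hPy s hs hs'
    have : s ∈ S ∩ S' := Finset.mem_inter.2 ⟨hs, hs'⟩
    rw [hSS, Finset.mem_insert, Finset.mem_singleton] at this
    rcases this with rfl | rfl <;> assumption
  set Y := X.filter fun P => P ∉ l ∧ P ∉ x ∧ P ∉ y with hY
  have h1 : Y.card ≤ ({A, B} : Finset (ℝ × ℝ)).card + ((Y.erase A).erase B).card :=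
    card_le_card_add_card fun P hP => by
      simp only [Finset.mem_insert, Finset.mem_singleton, Finset.mem_erase]
      tauto
  have h2 : ((Y.erase A).erase B).card ≤ (S \ S').card * (S' \ S).card := by
    apply card_le_mul_card_lines (fun s hs => hA.isLine s (Finset.mem_sdiff.1 hs).1)
      (fun s hs => hB.isLine s (Finset.mem_sdiff.1 hs).1)
    · rw [Finset.disjoint_left]
      intro s hs hs'
      exact (Finset.mem_sdiff.1 hs).2 (Finset.mem_sdiff.1 hs').1
    · intro P hP
      simp only [hY, Finset.mem_erase, Finset.mem_filter] at hP
      obtain ⟨hPB, hPA, hPX, hPl, hPx, hPy⟩ := hP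
      exact ⟨hA.exists_mem_sdiff hPX hPA hPl (hout P hPx hPy),
        hB.exists_mem_sdiff hPX hPB hPl fun s hs hs' => hout P hPx hPy s hs' hs⟩
  rw [hA.card_sdiff, hB.card_sdiff, Finset.inter_comm S' S, h] at h2
  have h3 := Finset.card_le_two (a := A) (b := B)
  omega

/-- The case of two nodes besides `A` in `IsStar.false_of_primary_nodes`. -/
lemma IsStar.false_of_two {A B C : ℝ × ℝ} {S SB SC : Finset (Set (ℝ × ℝ))} (hA : IsStar X l A S)
    (hB : IsStar X l B SB) (hC : IsStar X l C SC) (hne : [A, B, C].Nodup)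
    {r₁ r₂ r₃ r₄ : Set (ℝ × ℝ)} (hr₁ : r₁ ∈ S) (hr₂ : r₂ ∈ S) (hr₃ : r₃ ∈ S) (hr₄ : r₄ ∈ S)
    (hr : [r₁, r₂, r₃, r₄].Nodup) {T₁ T₂ T₃ T₄ : Finset (ℝ × ℝ)}
    (hT : ∀ P, P ∈ T₁ ∨ P ∈ T₂ ∨ P ∈ T₃ ∨ P ∈ T₄ → P ∈ X ∧ P ∉ l ∧ P ≠ B ∧ P ≠ C)
    (hT₁ : ∀ P ∈ T₁, P ∈ r₁) (hT₂ : ∀ P ∈ T₂, P ∈ r₂ ∧ P ∉ r₁)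
    (hT₃ : ∀ P ∈ T₃, P ∈ r₃ ∧ P ∉ r₁ ∧ P ∉ r₂)
    (hT₄ : ∀ P ∈ T₄, P ∈ r₄ ∧ P ∉ r₁ ∧ P ∉ r₂ ∧ P ∉ r₃) (e₁ e₂ : ℕ) (he : e₁ + e₂ ≤ 1)
    (h₁ : 5 ≤ T₁.card + e₁) (h₂ : 4 ≤ T₂.card + e₂) (h₃ : 3 ≤ T₃.card) (h₄ : 2 ≤ T₄.card) :
    False := by
  refine hA.false_of_primary_nodes (e := 1) ![B, C] ?_ ?_ ![SB, SC] ?_ ![r₁, r₂, r₃, r₄] ?_ ?_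
    ![T₁, T₂, T₃, T₄] ?_ ?_ ![e₁, e₂, 0, 0] ?_ ?_
  · exact (List.nodup_ofFn (f := ![B, C])).1 (by simp at hne ⊢; tauto)
  · simp at hne
    simp [Fin.forall_fin_succ]
    tauto
  · simp [Fin.forall_fin_succ, hB, hC]
  · simp [Fin.forall_fin_succ, hr₁, hr₂, hr₃, hr₄]
  · exact (List.nodup_ofFn (f := ![r₁, r₂, r₃, r₄])).1 (by simpa using hr)
  · intro i P hP
    have : P ∈ X ∧ P ∉ l ∧ P ≠ B ∧ P ≠ C := hT P (by fin_cases i <;> simp_all)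
    fin_cases i <;> simp at hP <;> simp [Fin.forall_fin_succ, this]
    exacts [hT₁ P hP, (hT₂ P hP).1, (hT₃ P hP).1, (hT₄ P hP).1]
  · intro i j hji P hP
    fin_cases i <;> fin_cases j <;> simp at hji hP ⊢
    exacts [(hT₂ P hP).2, (hT₃ P hP).2.1, (hT₃ P hP).2.2, (hT₄ P hP).2.1, (hT₄ P hP).2.2.1,
      (hT₄ P hP).2.2.2]
  · simpa [Fin.sum_univ_succ] using he
  · intro i
    fin_cases i <;> simp <;> omega

/-- The case of three nodes besides `A` in `IsStar.false_of_primary_nodes`. -/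
lemma IsStar.false_of_three {A B C D : ℝ × ℝ} {S SB SC SD : Finset (Set (ℝ × ℝ))}
    (hA : IsStar X l A S) (hB : IsStar X l B SB) (hC : IsStar X l C SC) (hD : IsStar X l D SD)
    (hne : [A, B, C, D].Nodup) {r₁ r₂ r₃ r₄ : Set (ℝ × ℝ)} (hr₁ : r₁ ∈ S) (hr₂ : r₂ ∈ S)
    (hr₃ : r₃ ∈ S) (hr₄ : r₄ ∈ S) (hr : [r₁, r₂, r₃, r₄].Nodup) {T₁ T₂ T₃ T₄ : Finset (ℝ × ℝ)}
    (hT : ∀ P, P ∈ T₁ ∨ P ∈ T₂ ∨ P ∈ T₃ ∨ P ∈ T₄ → P ∈ X ∧ P ∉ l ∧ P ≠ B ∧ P ≠ C ∧ P ≠ D)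
    (hT₁ : ∀ P ∈ T₁, P ∈ r₁) (hT₂ : ∀ P ∈ T₂, P ∈ r₂ ∧ P ∉ r₁)
    (hT₃ : ∀ P ∈ T₃, P ∈ r₃ ∧ P ∉ r₁ ∧ P ∉ r₂)
    (hT₄ : ∀ P ∈ T₄, P ∈ r₄ ∧ P ∉ r₁ ∧ P ∉ r₂ ∧ P ∉ r₃)
    (h₁ : 4 ≤ T₁.card) (h₂ : 3 ≤ T₂.card) (h₃ : 3 ≤ T₃.card) (h₄ : 2 ≤ T₄.card) :
    False := by
  refine hA.false_of_primary_nodes (e := 2) ![B, C, D] ?_ ?_ ![SB, SC, SD] ?_ ![r₁, r₂, r₃, r₄]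
    ?_ ?_ ![T₁, T₂, T₃, T₄] ?_ ?_ ![1, 1, 0, 0] ?_ ?_
  · exact (List.nodup_ofFn (f := ![B, C, D])).1 (by simp at hne ⊢; tauto)
  · simp at hne
    simp [Fin.forall_fin_succ]
    tauto
  · simp [Fin.forall_fin_succ, hB, hC, hD]
  · simp [Fin.forall_fin_succ, hr₁, hr₂, hr₃, hr₄]
  · exact (List.nodup_ofFn (f := ![r₁, r₂, r₃, r₄])).1 (by simpa using hr)
  · intro i P hP
    have : P ∈ X ∧ P ∉ l ∧ P ≠ B ∧ P ≠ C ∧ P ≠ D := hT P (by fin_cases i <;> simp_all)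
    fin_cases i <;> simp at hP <;> simp [Fin.forall_fin_succ, this]
    exacts [hT₁ P hP, (hT₂ P hP).1, (hT₃ P hP).1, (hT₄ P hP).1]
  · intro i j hji P hP
    fin_cases i <;> fin_cases j <;> simp at hji hP ⊢
    exacts [(hT₂ P hP).2, (hT₃ P hP).2.1, (hT₃ P hP).2.2, (hT₄ P hP).2.1, (hT₄ P hP).2.2.1,
      (hT₄ P hP).2.2.2]
  · simp [Fin.sum_univ_succ]
  · intro i
    fin_cases i <;> simp <;> omega

/-- If two stars have exactly one common line, it passes through all other nodes having a star
with the same base line. -/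
lemma IsStar.exists_of_card_inter_eq_one (hX : X.card = 21)
    (h5 : ∀ s, IsLine s → (X.filter (· ∈ s)).card ≤ 5) (hl : IsLine l) {A B : ℝ × ℝ}
    {S S' : Finset (Set (ℝ × ℝ))} (hA : IsStar X l A S) (hB : IsStar X l B S') (hAB : A ≠ B)
    (h : (S ∩ S').card = 1) :
    ∃ m ∈ S, m ∈ S' ∧ ∀ C S'', IsStar X l C S'' → C ≠ A → C ≠ B → C ∈ m := by
  obtain ⟨m, hSS⟩ := Finset.card_eq_one.1 h
  have hm : m ∈ S ∧ m ∈ S' := by rw [← Finset.mem_inter, hSS, Finset.mem_singleton]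
  refine ⟨m, hm.1, hm.2, fun C S'' hC hCA hCB => ?_⟩
  by_contra hCm
  have hout : ∀ P, P ∉ m → ∀ s ∈ S, s ∈ S' → P ∉ s := by
    intro P hPm s hs hs'
    have : s ∈ S ∩ S' := Finset.mem_inter.2 ⟨hs, hs'⟩
    rw [hSS, Finset.mem_singleton] at this
    rwa [this]
  set Y := X.filter fun P => P ∉ l ∧ P ∉ m ∧ P ≠ A ∧ P ≠ B with hY
  have hYS : ∀ P ∈ Y, ∃ s ∈ S \ S', P ∈ s := fun P hP => by
    obtain ⟨hPX, hPl, hPm, hPA, -⟩ := Finset.mem_filter.1 hP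
    exact hA.exists_mem_sdiff hPX hPA hPl (hout P hPm)
  have hYS' : ∀ P ∈ Y, ∃ s ∈ S' \ S, P ∈ s := fun P hP => by
    obtain ⟨hPX, hPl, hPm, -, hPB⟩ := Finset.mem_filter.1 hP
    exact hB.exists_mem_sdiff hPX hPB hPl fun s hs hs' => hout P hPm s hs' hs
  have hcS := hA.card_sdiff S'
  have hcS' := hB.card_sdiff S
  rw [h] at hcS
  rw [Finset.inter_comm, h] at hcS'
  have hlS : ∀ s ∈ S \ S', IsLine s := fun s hs => hA.isLine s (Finset.mem_sdiff.1 hs).1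
  have hlS' : ∀ s ∈ S' \ S, IsLine s := fun s hs => hB.isLine s (Finset.mem_sdiff.1 hs).1
  have hdisj : Disjoint (S \ S') (S' \ S) := by
    rw [Finset.disjoint_left]
    intro s hs hs'
    exact (Finset.mem_sdiff.1 hs).2 (Finset.mem_sdiff.1 hs').1
  have hrow : ∀ r ∈ S \ S', (Y.filter (· ∈ r)).card ≤ 3 := fun r hr => by
    refine (card_le_card_lines hlS' (hlS r hr) (Finset.disjoint_left.1 hdisj hr) ?_).trans hcS'.le
    intro P hP
    obtain ⟨hPY, hPr⟩ := Finset.mem_filter.1 hP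
    exact ⟨hPr, hYS' P hPY⟩
  have hYle : Y.card ≤ 9 := by
    have := card_le_mul_card_lines hlS hlS' hdisj fun P hP => ⟨hYS P hP, hYS' P hP⟩
    rwa [hcS, hcS'] at this
  set M := X.filter fun P => P ∉ l ∧ P ∈ m with hM
  have hMle : M.card ≤ 5 := (Finset.card_le_card fun P hP => by
    simp only [hM, Finset.mem_filter] at hP ⊢
    exact ⟨hP.1, hP.2.2⟩).trans (h5 m (hA.isLine m hm.1))
  have hsum : X.card ≤ (X.filter (· ∈ l)).card + (M.card + (({A, B} : Finset (ℝ × ℝ)).card +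
      Y.card)) := by
    refine (card_le_card_add_card (Y₂ := M ∪ ({A, B} ∪ Y)) fun P hP => ?_).trans
      (add_le_add_right ((Finset.card_union_le _ _).trans
        (add_le_add_right (Finset.card_union_le _ _) _)) _)
    simp only [hM, hY, Finset.mem_union, Finset.mem_filter, Finset.mem_insert,
      Finset.mem_singleton]
    tauto
  have hl5 := h5 l hl
  have h2 := Finset.card_le_two (a := A) (b := B)
  have hCY : C ∈ Y := Finset.mem_filter.2 ⟨hC.mem, hC.notMem_base, hCm, hCA, hCB⟩
  obtain ⟨r₃, hr₃, hCr₃⟩ := hYS C hCY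
  obtain ⟨r₁, r₂, hr₁₂, hr⟩ := Finset.card_eq_two.1
    (by rw [Finset.card_erase_of_mem hr₃, hcS] : ((S \ S').erase r₃).card = 2)
  have hr₁ : r₁ ∈ (S \ S').erase r₃ := by simp [hr]
  have hr₂ : r₂ ∈ (S \ S').erase r₃ := by simp [hr]
  rw [Finset.mem_erase] at hr₁ hr₂
  have hcov : ∀ P ∈ Y, P ∈ r₁ ∨ P ∈ r₂ ∨ P ∈ r₃ := fun P hP => by
    obtain ⟨s, hs, hPs⟩ := hYS P hP
    by_cases hs3 : s = r₃
    · exact Or.inr (Or.inr (hs3 ▸ hPs))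
    · have : s ∈ (S \ S').erase r₃ := Finset.mem_erase.2 ⟨hs3, hs⟩
      rw [hr, Finset.mem_insert, Finset.mem_singleton] at this
      rcases this with rfl | rfl <;> simp [hPs]
  set T₁ := (Y.erase C).filter (· ∈ r₁) with hT₁
  set T₂ := (Y.erase C).filter (fun P => P ∈ r₂ ∧ P ∉ r₁) with hT₂
  set T₃ := (Y.erase C).filter (fun P => P ∈ r₃ ∧ P ∉ r₁ ∧ P ∉ r₂) with hT₃
  have hT₁le : T₁.card ≤ 3 := (Finset.card_le_card
    (Finset.filter_subset_filter _ (Finset.erase_subset C Y))).trans (hrow r₁ hr₁.2)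
  have hT₂le : T₂.card ≤ 3 := (Finset.card_le_card fun P hP => by
    simp only [hT₂, Finset.mem_filter, Finset.mem_erase] at hP ⊢
    exact ⟨hP.1.2, hP.2.1⟩).trans (hrow r₂ hr₂.2)
  have hT₃le : T₃.card ≤ 2 := by
    have : T₃.card ≤ ((Y.filter (· ∈ r₃)).erase C).card := Finset.card_le_card fun P hP => by
      simp only [hT₃, Finset.mem_filter, Finset.mem_erase] at hP ⊢
      exact ⟨hP.1.1, hP.1.2, hP.2.1⟩
    rw [Finset.card_erase_of_mem (Finset.mem_filter.2 ⟨hCY, hCr₃⟩)] at this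
    exact this.trans (Nat.sub_le_sub_right (hrow r₃ hr₃) 1)
  have hsumY : (Y.erase C).card ≤ T₁.card + (T₂.card + T₃.card) := by
    refine (card_le_card_add_card (Y₂ := T₂ ∪ T₃) fun P hP => ?_).trans
      (add_le_add_right (Finset.card_union_le _ _) _)
    have := hcov P (Finset.mem_of_mem_erase hP)
    simp only [hT₁, hT₂, hT₃, Finset.mem_union, Finset.mem_filter]
    tauto
  rw [Finset.card_erase_of_mem hCY] at hsumY
  have hmS : m ∉ S \ S' := fun h => (Finset.mem_sdiff.1 h).2 hm.2
  have hmr₁ : m ≠ r₁ := fun h => hmS (h ▸ hr₁.2)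
  have hmr₂ : m ≠ r₂ := fun h => hmS (h ▸ hr₂.2)
  have hmr₃ : m ≠ r₃ := fun h => hmS (h ▸ hr₃)
  have hBm := hB.notMem_line m hm.2
  have hY' : ∀ P ∈ Y.erase C, P ∈ X ∧ P ∉ l ∧ P ∉ m ∧ P ≠ B ∧ P ≠ C := fun P hP => by
    simp only [hY, Finset.mem_erase, Finset.mem_filter] at hP
    tauto
  refine hA.false_of_two hB hC (T₁ := M) (T₂ := T₁) (T₃ := T₂) (T₄ := T₃) ?_ hm.1
    (Finset.mem_sdiff.1 hr₁.2).1 (Finset.mem_sdiff.1 hr₂.2).1 (Finset.mem_sdiff.1 hr₃).1 ?_ ?_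
    (fun P hP => (Finset.mem_filter.1 hP).2.2) ?_ ?_ ?_ 0 1 le_rfl ?_ ?_ ?_ ?_
  · simpa using ⟨⟨hAB, hCA.symm⟩, hCB.symm⟩
  · simpa using ⟨⟨hmr₁, hmr₂, hmr₃⟩, ⟨hr₁₂, hr₁.1⟩, hr₂.1⟩
  · rintro P (hP | hP | hP | hP)
    · obtain ⟨hPX, hPl, hPm⟩ := Finset.mem_filter.1 hP
      exact ⟨hPX, hPl, fun h => hBm (h ▸ hPm), fun h => hCm (h ▸ hPm)⟩
    all_goals
      have := hY' P (Finset.mem_filter.1 hP).1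
      tauto
  · intro P hP
    obtain ⟨hPY, h⟩ := Finset.mem_filter.1 hP
    exact ⟨h, (hY' P hPY).2.2.1⟩
  · intro P hP
    obtain ⟨hPY, h, h'⟩ := Finset.mem_filter.1 hP
    exact ⟨h, (hY' P hPY).2.2.1, h'⟩
  · intro P hP
    obtain ⟨hPY, h, h'⟩ := Finset.mem_filter.1 hP
    exact ⟨h, (hY' P hPY).2.2.1, h'⟩
  all_goals omega

lemma IsStar.false_of_card_inter_eq_one (hX : X.card = 21)
    (h5 : ∀ s, IsLine s → (X.filter (· ∈ s)).card ≤ 5) (hl : IsLine l) {A B C D E : ℝ × ℝ}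
    {SA SB SC SD SE : Finset (Set (ℝ × ℝ))} (hA : IsStar X l A SA) (hB : IsStar X l B SB)
    (hC : IsStar X l C SC) (hD : IsStar X l D SD) (hE : IsStar X l E SE)
    (hne : [A, B, C, D, E].Nodup) (hAB : (SA ∩ SB).card = 1) (hAC : (SA ∩ SC).card = 1) :
    False := by
  simp only [List.nodup_cons, List.mem_cons, List.not_mem_nil, or_false, not_or] at hne
  obtain ⟨m, hmA, hmB, hm⟩ := hA.exists_of_card_inter_eq_one hX h5 hl hB hne.1.1 hAB
  obtain ⟨m', hmA', hmC', hm'⟩ := hA.exists_of_card_inter_eq_one hX h5 hl hC hne.1.2.1 hAC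
  have h : m = m' := (hA.isLine m hmA).eq_of_mem (hA.isLine m' hmA') hne.2.2.2.1
    (hm D SD hD (by tauto) (by tauto)) (hm E SE hE (by tauto) (by tauto))
    (hm' D SD hD (by tauto) (by tauto)) (hm' E SE hE (by tauto) (by tauto))
  exact hC.notMem_line m' hmC' (h ▸ hm C SC hC (by tauto) (by tauto))

lemma IsStar.false_of_inter_eq {A B C D : ℝ × ℝ} {SA SB SC SD : Finset (Set (ℝ × ℝ))}
    (hA : IsStar X l A SA) (hB : IsStar X l B SB) (hC : IsStar X l C SC) (hD : IsStar X l D SD)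
    (hne : [A, B, C, D].Nodup) (h3 : (SA ∩ SB).card = 3) (hBC : SA ∩ SB = SA ∩ SC)
    (hBD : SA ∩ SB = SA ∩ SD) : False := by
  simp only [List.nodup_cons, List.mem_cons, List.not_mem_nil, or_false, not_or] at hne
  obtain ⟨a, ha⟩ := Finset.card_eq_one.1 (by rw [hA.card_sdiff, h3] : (SA \ SB).card = 1)
  obtain ⟨b, hb⟩ := Finset.card_eq_one.1
    (by rw [hB.card_sdiff, Finset.inter_comm, h3] : (SB \ SA).card = 1)
  have haS : a ∈ SA \ SB := by simp [ha]
  have hbS : b ∈ SB \ SA := by simp [hb]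
  rw [Finset.mem_sdiff] at haS hbS
  have key : ∀ P S, IsStar X l P S → SA ∩ SB = SA ∩ S → P ≠ A → P ≠ B → P ∈ a ∧ P ∈ b := by
    intro P S hP hS hPA hPB
    have hout : ∀ s, s ∈ SA → s ∈ SB → P ∉ s := fun s hsA hsB => by
      have : s ∈ SA ∩ S := hS ▸ Finset.mem_inter.2 ⟨hsA, hsB⟩
      exact hP.notMem_line s (Finset.mem_inter.1 this).2
    obtain ⟨s, hs, hPs⟩ := hA.exists_mem_sdiff hP.mem hPA hP.notMem_base hout
    obtain ⟨t, ht, hPt⟩ := hB.exists_mem_sdiff hP.mem hPB hP.notMem_base fun s h1 h2 => hout s h2 h1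
    rw [ha, Finset.mem_singleton] at hs
    rw [hb, Finset.mem_singleton] at ht
    exact ⟨hs ▸ hPs, ht ▸ hPt⟩
  have h1 := key C SC hC hBC (by tauto) (by tauto)
  have h2 := key D SD hD hBD (by tauto) (by tauto)
  have : a = b := (hA.isLine a haS.1).eq_of_mem (hB.isLine b hbS.1) hne.2.2.1 h1.1 h2.1 h1.2 h2.2
  exact hbS.2 (this ▸ haS.1)

/-- Two stars sharing two different triples of lines with a third one: some two of their common
lines and the base line contain all but at most six nodes. -/
lemma IsStar.exists_of_inter_ne {A B C : ℝ × ℝ} {SA SB SC : Finset (Set (ℝ × ℝ))}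
    (hA : IsStar X l A SA) (hB : IsStar X l B SB) (hC : IsStar X l C SC) (hCB : C ≠ B)
    (hAB : (SA ∩ SB).card = 3) (hAC : (SA ∩ SC).card = 3) (hne : SA ∩ SB ≠ SA ∩ SC) :
    ∃ x y, IsLine x ∧ IsLine y ∧ (X.filter fun P => P ∉ l ∧ P ∉ x ∧ P ∉ y).card ≤ 6 := by
  have hK : ((SA ∩ SB) ∩ (SA ∩ SC)).card = 2 := by
    have h1 := Finset.card_union_add_card_inter (SA ∩ SB) (SA ∩ SC)
    have h2 : ((SA ∩ SB) ∪ (SA ∩ SC)).card ≤ 4 :=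
      (Finset.card_le_card (Finset.union_subset Finset.inter_subset_left
        Finset.inter_subset_left)).trans hA.card.le
    have h3 : ((SA ∩ SB) ∩ (SA ∩ SC)).card < 3 := by
      by_contra! hge
      have e1 := Finset.eq_of_subset_of_card_le
        (Finset.inter_subset_left (s₁ := SA ∩ SB) (s₂ := SA ∩ SC)) (by omega)
      have e2 := Finset.eq_of_subset_of_card_le
        (Finset.inter_subset_right (s₁ := SA ∩ SB) (s₂ := SA ∩ SC)) (by omega)
      exact hne (e1.symm.trans e2)
    omega
  have hBC2 : 2 ≤ (SB ∩ SC).card := hK ▸ Finset.card_le_card fun s hs => by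
    simp only [Finset.mem_inter] at hs ⊢
    tauto
  by_cases hBCeq : (SB ∩ SC).card = 2
  · exact hB.exists_of_card_inter_eq_two hC hBCeq
  have hBC3 : (SB ∩ SC).card = 3 := by
    by_contra h
    have hle : (SB ∩ SC).card ≤ 4 := (Finset.card_le_card Finset.inter_subset_left).trans hB.card.le
    have e1 := Finset.eq_of_subset_of_card_le
      (Finset.inter_subset_left (s₁ := SB) (s₂ := SC)) (by rw [hB.card]; omega)
    have e2 := Finset.eq_of_subset_of_card_le
      (Finset.inter_subset_right (s₁ := SB) (s₂ := SC)) (by rw [hC.card]; omega)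
    exact hB.ne_of_ne hC hCB.symm (e1.symm.trans e2)
  obtain ⟨x, y, hxy, hKxy⟩ := Finset.card_eq_two.1 hK
  have hcommon : ∀ s, s ∈ SA → s ∈ SB → s ∈ SC → s = x ∨ s = y := fun s h1 h2 h3 => by
    have : s ∈ (SA ∩ SB) ∩ (SA ∩ SC) := by simp [h1, h2, h3]
    simpa [hKxy] using this
  have hx : x ∈ (SA ∩ SB) ∩ (SA ∩ SC) := by simp [hKxy]
  have hy : y ∈ (SA ∩ SB) ∩ (SA ∩ SC) := by simp [hKxy]
  simp only [Finset.mem_inter] at hx hy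
  have hpair : ∀ {A B C : ℝ × ℝ} {SA SB SC : Finset (Set (ℝ × ℝ))}, IsStar X l A SA →
      IsStar X l B SB → IsStar X l C SC → (SA ∩ SB).card = 3 → (SA ∩ SC).card = 3 →
      (SB ∩ SC).card = 3 → x ∈ SA → x ∈ SB → x ∈ SC → y ∈ SA → y ∈ SB → y ∈ SC →
      (∀ s, s ∈ SA → s ∈ SB → s ∈ SC → s = x ∨ s = y) →
      ∃ z, IsLine z ∧ z ∈ SA ∧ z ∈ SB ∧ z ∉ SC ∧
        ∀ s, s ∈ SA → s ∈ SB → s = x ∨ s = y ∨ s = z := by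
    intro A B C SA SB SC hA hB hC h1 h2 h3 a1 a2 a3 b1 b2 b3 hc
    have hcard : ((SA ∩ SB).erase x |>.erase y).card = 1 := by
      rw [Finset.card_erase_of_mem, Finset.card_erase_of_mem, h1]
      · simp [a1, a2]
      · simp [b1, b2, hxy.symm]
    obtain ⟨z, hz⟩ := Finset.card_eq_one.1 hcard
    have hzm : z ∈ ((SA ∩ SB).erase x).erase y := by simp [hz]
    simp only [Finset.mem_erase, Finset.mem_inter] at hzm
    refine ⟨z, hA.isLine z hzm.2.2.1, hzm.2.2.1, hzm.2.2.2, fun hzC => ?_, fun s h h' => ?_⟩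
    · have := hc z hzm.2.2.1 hzm.2.2.2 hzC
      tauto
    · by_contra! hs
      have : s ∈ ((SA ∩ SB).erase x).erase y := by simp [h, h', hs.1, hs.2.1]
      rw [hz, Finset.mem_singleton] at this
      exact hs.2.2 this
  obtain ⟨z, hzl, hzA, hzB, hzC, hz⟩ := hpair hA hB hC hAB hAC hBC3 (by tauto) (by tauto)
    (by tauto) (by tauto) (by tauto) (by tauto) hcommon
  obtain ⟨a, hal, haA, haC, haB, ha⟩ := hpair hA hC hB hAC hAB (by rwa [Finset.inter_comm])
    (by tauto) (by tauto) (by tauto) (by tauto) (by tauto) (by tauto)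
    fun s h1 h2 h3 => hcommon s h1 h3 h2
  obtain ⟨b, hbl, hbB, hbC, hbA, hb⟩ := hpair hB hC hA hBC3 (by rwa [Finset.inter_comm])
    (by rwa [Finset.inter_comm]) (by tauto) (by tauto) (by tauto) (by tauto) (by tauto) (by tauto)
    fun s h1 h2 h3 => hcommon s h3 h1 h2
  have hmem : ∀ {A B C : ℝ × ℝ} {SA SB SC : Finset (Set (ℝ × ℝ))} {z a : Set (ℝ × ℝ)},
      IsStar X l A SA → (SA ∩ SB).card = 3 →
      (∀ s, s ∈ SA → s ∈ SB → s = x ∨ s = y ∨ s = z) → a ∈ SA → a ∉ SB →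
      ∀ P ∈ X, P ∉ l → P ∉ x → P ∉ y → P ≠ A → P ∈ z ∨ P ∈ a := by
    intro A B C SA SB SC z a hA h3 hz haA haB P hPX hPl hPx hPy hPA
    obtain ⟨a', ha'⟩ := Finset.card_eq_one.1 (by rw [hA.card_sdiff, h3] : (SA \ SB).card = 1)
    have haa : a ∈ SA \ SB := by simp [haA, haB]
    rw [ha', Finset.mem_singleton] at haa
    obtain ⟨s, hs, hPs⟩ := hA.cover P hPX hPA hPl
    by_cases hsB : s ∈ SB
    · rcases hz s hs hsB with rfl | rfl | rfl
      · exact absurd hPs hPx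
      · exact absurd hPs hPy
      · exact Or.inl hPs
    · have : s ∈ SA \ SB := by simp [hs, hsB]
      rw [ha', Finset.mem_singleton] at this
      rw [haa, ← this]
      exact Or.inr hPs
  refine ⟨x, y, hA.isLine x hx.1.1, hA.isLine y hy.1.1, ?_⟩
  set Y := X.filter fun P => P ∉ l ∧ P ∉ x ∧ P ∉ y with hY
  have hone : ∀ {s t : Set (ℝ × ℝ)}, IsLine s → IsLine t → s ≠ t →
      (Y.filter fun P => P ∈ s ∧ P ∈ t).card ≤ 1 := by
    intro s t hs ht hst
    refine Finset.card_le_one.2 fun P hP Q hQ => ?_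
    simp only [Finset.mem_filter] at hP hQ
    by_contra hPQ
    exact hst (hs.eq_of_mem ht hPQ hP.2.1 hQ.2.1 hP.2.2 hQ.2.2)
  have hsum : Y.card ≤ ({A, B, C} : Finset (ℝ × ℝ)).card +
      ((Y.filter fun P => P ∈ z ∧ P ∈ a).card + ((Y.filter fun P => P ∈ z ∧ P ∈ b).card +
        (Y.filter fun P => P ∈ a ∧ P ∈ b).card)) := by
    refine (card_le_card_add_card (Y₂ := (Y.filter fun P => P ∈ z ∧ P ∈ a) ∪
      ((Y.filter fun P => P ∈ z ∧ P ∈ b) ∪ (Y.filter fun P => P ∈ a ∧ P ∈ b))) fun P hP => ?_).trans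
      (add_le_add_right ((Finset.card_union_le _ _).trans
        (add_le_add_right (Finset.card_union_le _ _) _)) _)
    obtain ⟨hPX, hPl, hPx, hPy⟩ := Finset.mem_filter.1 hP
    have eA := hmem (C := C) (SC := SC) (B := B) hA hAB hz haA haB P hPX hPl hPx hPy
    have eB := hmem (C := C) (SC := SC) (B := A) (SB := SA) hB (by rwa [Finset.inter_comm])
      (fun s h1 h2 => hz s h2 h1) hbB hbA P hPX hPl hPx hPy
    have eC := hmem (C := C) (SC := SC) (B := A) (SB := SA) hC (by rwa [Finset.inter_comm])
      (fun s h1 h2 => ha s h2 h1) hbC hbA P hPX hPl hPx hPy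
    simp only [Finset.mem_union, Finset.mem_filter, hP, Finset.mem_insert, Finset.mem_singleton,
      true_and]
    tauto
  have h1 := hone hzl hal (fun h => haB (h ▸ hzB))
  have h2 := hone hzl hbl (fun h => hbA (h ▸ hzA))
  have h3 := hone hal hbl (fun h => hbA (h ▸ haA))
  have h4 := Finset.card_le_three (a := A) (b := B) (c := C)
  omega

lemma exists_lt_card_filter_mem {Y : Finset (ℝ × ℝ)} {S : Finset (Set (ℝ × ℝ))}
    (hY : ∀ P ∈ Y, ∃ s ∈ S, P ∈ s) {k : ℕ} (hk : S.card * k < Y.card) :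
    ∃ s ∈ S, k < (Y.filter (· ∈ s)).card := by
  by_contra! h
  refine hk.not_ge ((Finset.card_le_card fun P hP => ?_).trans
    (Finset.card_biUnion_le_card_mul S (fun s => Y.filter (· ∈ s)) k h))
  obtain ⟨s, hs, hPs⟩ := hY P hP
  exact Finset.mem_biUnion.2 ⟨s, hs, Finset.mem_filter.2 ⟨hP, hPs⟩⟩

lemma exists_pair_of_card_eq_four {α : Type*} {S : Finset α} (hS : S.card = 4) {a b : α}
    (ha : a ∈ S) (hb : b ∈ S) (hab : a ≠ b) :
    ∃ c ∈ S, ∃ d ∈ S, [a, b, c, d].Nodup ∧ ∀ s ∈ S, s = a ∨ s = b ∨ s = c ∨ s = d := by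
  obtain ⟨c, d, hcd, h⟩ := Finset.card_eq_two.1
    (by rw [Finset.card_erase_of_mem (by simp [hb, hab.symm]), Finset.card_erase_of_mem ha, hS] :
      ((S.erase a).erase b).card = 2)
  have hmem : ∀ s, s ∈ (S.erase a).erase b ↔ s = c ∨ s = d := by simp [h]
  simp only [Finset.mem_erase] at hmem
  have hc := (hmem c).2 (Or.inl rfl)
  have hd := (hmem d).2 (Or.inr rfl)
  refine ⟨c, hc.2.2, d, hd.2.2, ?_, fun s hs => ?_⟩
  · simp only [List.nodup_cons, List.mem_cons, List.not_mem_nil, or_false, not_or]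
    exact ⟨⟨hab, hc.2.1.symm, hd.2.1.symm⟩, ⟨hc.1.symm, hd.1.symm⟩, hcd, by simp⟩
  · have := hmem s
    tauto

lemma IsStar.false_of_disjoint (hX : X.card = 21)
    (h5 : ∀ s, IsLine s → (X.filter (· ∈ s)).card ≤ 5) (hl : IsLine l) {A B C D E : ℝ × ℝ}
    {SA SB SC SD SE : Finset (Set (ℝ × ℝ))} (hA : IsStar X l A SA) (hB : IsStar X l B SB)
    (hC : IsStar X l C SC) (hD : IsStar X l D SD) (hE : IsStar X l E SE)
    (hne : [A, B, C, D, E].Nodup) (hAB : (SA ∩ SB).card = 0) : False := by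
  rw [Finset.card_eq_zero, ← Finset.disjoint_iff_inter_eq_empty] at hAB
  set Y := X.filter fun P => P ∉ l ∧ P ≠ A ∧ P ≠ B with hY
  have hYA : ∀ P ∈ Y, ∃ s ∈ SA, P ∈ s := fun P hP => by
    obtain ⟨hPX, hPl, hPA, -⟩ := Finset.mem_filter.1 hP
    exact hA.cover P hPX hPA hPl
  have hYB : ∀ P ∈ Y, ∃ s ∈ SB, P ∈ s := fun P hP => by
    obtain ⟨hPX, hPl, -, hPB⟩ := Finset.mem_filter.1 hP
    exact hB.cover P hPX hPB hPl
  have hYmem : ∀ P ∈ Y, P ∈ X ∧ P ∉ l ∧ P ≠ B := fun P hP => by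
    obtain ⟨hPX, hPl, -, hPB⟩ := Finset.mem_filter.1 hP
    exact ⟨hPX, hPl, hPB⟩
  have hrow : ∀ r ∈ SA, (Y.filter (· ∈ r)).card ≤ 4 := fun r hr => by
    refine (card_le_card_lines hB.isLine (hA.isLine r hr) (Finset.disjoint_left.1 hAB hr) ?_).trans
      hB.card.le
    intro P hP
    obtain ⟨hPY, hPr⟩ := Finset.mem_filter.1 hP
    exact ⟨hPr, hYB P hPY⟩
  have hYcard : 14 ≤ Y.card := by
    have hsum : X.card ≤ (X.filter (· ∈ l)).card + (({A, B} : Finset (ℝ × ℝ)).card + Y.card) := by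
      refine (card_le_card_add_card (Y₂ := {A, B} ∪ Y) fun P hP => ?_).trans
        (add_le_add_right (Finset.card_union_le _ _) _)
      simp only [hY, Finset.mem_union, Finset.mem_filter, Finset.mem_insert,
        Finset.mem_singleton]
      tauto
    have hl5 := h5 l hl
    have h2 := Finset.card_le_two (a := A) (b := B)
    omega
  have hoff : ∀ r ∈ SA, ∀ (p : ℝ × ℝ → Prop) (T : Finset (ℝ × ℝ)),
      (∀ P ∈ T, P ∈ Y ∧ P ∈ r ∧ p P) → 4 ≤ T.card → ∀ P ∈ Y, P ∈ r → p P := by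
    intro r hr p T hT h4 P hP hPr
    have hsub : T ⊆ Y.filter (· ∈ r) := fun Q hQ =>
      Finset.mem_filter.2 ⟨(hT Q hQ).1, (hT Q hQ).2.1⟩
    have heq := Finset.eq_of_subset_of_card_le hsub ((hrow r hr).trans h4)
    exact (hT P (heq ▸ Finset.mem_filter.2 ⟨hP, hPr⟩)).2.2
  -- the set of nodes off two given lines
  set Z : Set (ℝ × ℝ) → Set (ℝ × ℝ) → Finset (ℝ × ℝ) :=
    fun r s => Y.filter fun P => P ∉ r ∧ P ∉ s with hZ
  have hZcard : ∀ r ∈ SA, ∀ s ∈ SA, 6 ≤ (Z r s).card := fun r hr s hs => by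
    have h1 := hrow r hr
    have h2 := hrow s hs
    have : Y.card ≤ (Y.filter (· ∈ r)).card + ((Y.filter (· ∈ s)).card + (Z r s).card) := by
      refine (card_le_card_add_card (Y₂ := Y.filter (· ∈ s) ∪ Z r s) fun P hP => ?_).trans
        (add_le_add_right (Finset.card_union_le _ _) _)
      simp only [hZ, Finset.mem_union, Finset.mem_filter]
      tauto
    omega
  have huser : ∀ {P S}, IsStar X l P S → P ≠ A → P ≠ B → P ∈ Y := fun hP hPA hPB =>
    Finset.mem_filter.2 ⟨hP.mem, hP.notMem_base, hPA, hPB⟩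
  -- two lines containing four nodes each, without common nodes
  set F : Set (ℝ × ℝ) → Set (ℝ × ℝ) → Prop := fun r s => r ∈ SA ∧ s ∈ SA ∧ r ≠ s ∧
    4 ≤ (Y.filter (· ∈ r)).card ∧ 4 ≤ (Y.filter (· ∈ s)).card ∧ ∀ P ∈ Y, P ∈ r → P ∉ s with hF
  have hFsymm : ∀ {r s}, F r s → F s r := fun ⟨h1, h2, h3, h4, h5, h6⟩ =>
    ⟨h2, h1, h3.symm, h5, h4, fun P hP hs hr => h6 P hP hr hs⟩
  have htwo : ∀ {P S}, IsStar X l P S → P ≠ A → P ≠ B → ∀ {r₁ r₂ r₃ r₄}, F r₁ r₂ →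
      r₃ ∈ SA → r₄ ∈ SA → [r₁, r₂, r₃, r₄].Nodup → P ∉ r₁ → P ∉ r₂ →
      3 ≤ (((Z r₁ r₂).erase P).filter (· ∈ r₃)).card →
      2 ≤ (((Z r₁ r₂).erase P).filter fun Q => Q ∈ r₄ ∧ Q ∉ r₃).card → False := by
    rintro P S hP hPA hPB r₁ r₂ r₃ r₄ ⟨hr₁, hr₂, -, h1, h2, h12⟩ hr₃ hr₄ hnd hP1 hP2 h3 h4
    have hZmem : ∀ Q ∈ (Z r₁ r₂).erase P, Q ∈ Y ∧ Q ≠ P ∧ Q ∉ r₁ ∧ Q ∉ r₂ := fun Q hQ => by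
      obtain ⟨hQP, hQ⟩ := Finset.mem_erase.1 hQ
      obtain ⟨hQY, hQr⟩ := Finset.mem_filter.1 hQ
      exact ⟨hQY, hQP, hQr⟩
    have hmem : ∀ Q ∈ Y, Q ≠ P → Q ∈ X ∧ Q ∉ l ∧ Q ≠ B ∧ Q ≠ P := fun Q hQ hQP =>
      ⟨(hYmem Q hQ).1, (hYmem Q hQ).2.1, (hYmem Q hQ).2.2, hQP⟩
    refine hA.false_of_two hB hP ?_ hr₁ hr₂ hr₃ hr₄ hnd ?_
      (fun Q hQ => (Finset.mem_filter.1 hQ).2)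
      (fun Q hQ => ⟨(Finset.mem_filter.1 hQ).2, fun h =>
        h12 Q (Finset.mem_filter.1 hQ).1 h (Finset.mem_filter.1 hQ).2⟩)
      (fun Q hQ => ⟨(Finset.mem_filter.1 hQ).2, (hZmem Q (Finset.mem_filter.1 hQ).1).2.2⟩)
      (fun Q hQ => ⟨(Finset.mem_filter.1 hQ).2.1, (hZmem Q (Finset.mem_filter.1 hQ).1).2.2.1,
        (hZmem Q (Finset.mem_filter.1 hQ).1).2.2.2, (Finset.mem_filter.1 hQ).2.2⟩)
      1 0 le_rfl (Nat.succ_le_succ h1) h2 h3 h4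
    · simp only [List.nodup_cons, List.mem_cons, List.not_mem_nil, or_false, not_or] at hne ⊢
      exact ⟨⟨hne.1.1, hPA.symm⟩, hPB.symm, by simp⟩
    · rintro Q (hQ | hQ | hQ | hQ)
      · obtain ⟨hQY, hQr⟩ := Finset.mem_filter.1 hQ
        exact hmem Q hQY fun h => hP1 (h ▸ hQr)
      · obtain ⟨hQY, hQr⟩ := Finset.mem_filter.1 hQ
        exact hmem Q hQY fun h => hP2 (h ▸ hQr)
      · obtain ⟨hQY, hQP, -⟩ := hZmem Q (Finset.mem_filter.1 hQ).1
        exact hmem Q hQY hQP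
      · obtain ⟨hQY, hQP, -⟩ := hZmem Q (Finset.mem_filter.1 hQ).1
        exact hmem Q hQY hQP
  have hthree : ∀ {r₁ r₂ r₃}, F r₁ r₂ → F r₁ r₃ → F r₂ r₃ → False := by
    intro r₁ r₂ r₃ h12 h13 h23
    obtain ⟨r₄, hr₄, hnd, hcov⟩ : ∃ r₄ ∈ SA, [r₁, r₂, r₃, r₄].Nodup ∧
        ∀ s ∈ SA, s = r₁ ∨ s = r₂ ∨ s = r₃ ∨ s = r₄ := by
      obtain ⟨c, hc, d, hd, hnd, hcov⟩ :=
        exists_pair_of_card_eq_four hA.card h12.1 h12.2.1 h12.2.2.1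
      rcases hcov r₃ h13.2.1 with h | h | h | h
      · exact absurd h.symm h13.2.2.1
      · exact absurd h.symm h23.2.2.1
      · exact ⟨d, hd, h ▸ hnd, h ▸ hcov⟩
      · refine ⟨c, hc, h ▸ ?_, h ▸ fun s hs => ?_⟩
        · refine (List.Perm.nodup_iff ?_).1 hnd
          exact ((List.Perm.swap d c []).cons r₂).cons r₁
        · have := hcov s hs
          tauto
    set G := Y.filter fun P => ∀ s ∈ SA, s ≠ r₄ → P ∉ s with hG
    have hGr : ∀ P ∈ G, P ∈ r₄ := fun P hP => by
      obtain ⟨hPY, h⟩ := Finset.mem_filter.1 hP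
      obtain ⟨s, hs, hPs⟩ := hYA P hPY
      by_contra hPr
      exact h s hs (fun h => hPr (h ▸ hPs)) hPs
    have hG2 : 2 ≤ G.card := by
      have h1 := hrow r₁ h12.1
      have h2 := hrow r₂ h12.2.1
      have h3 := hrow r₃ h13.2.1
      have : Y.card ≤ (Y.filter (· ∈ r₁)).card + ((Y.filter (· ∈ r₂)).card +
          ((Y.filter (· ∈ r₃)).card + G.card)) := by
        refine (card_le_card_add_card (Y₂ := Y.filter (· ∈ r₂) ∪ (Y.filter (· ∈ r₃) ∪ G))
          fun P hP => ?_).trans (add_le_add_right ((Finset.card_union_le _ _).trans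
            (add_le_add_right (Finset.card_union_le _ _) _)) _)
        simp only [hG, Finset.mem_union, Finset.mem_filter]
        by_contra! h
        obtain ⟨s, hs, hs4, hPs⟩ := h.2.2.2 hP
        rcases hcov s hs with rfl | rfl | rfl | rfl
        exacts [h.1 hP hPs, h.2.1 hP hPs, h.2.2.1 hP hPs, hs4 rfl]
      omega
    have key : ∀ {P S}, IsStar X l P S → P ≠ A → P ≠ B → 2 ≤ (G.erase P).card →
        ∀ {r₁ r₂ r₃}, F r₁ r₂ → F r₁ r₃ → F r₂ r₃ → [r₁, r₂, r₃, r₄].Nodup → P ∉ r₁ → P ∉ r₂ →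
        False := by
      intro P S hP hPA hPB h2 r₁ r₂ r₃ h12 h13 h23 hnd hP1 hP2
      refine htwo hP hPA hPB h12 h13.2.1 hr₄ hnd hP1 hP2 ?_ (h2.trans (Finset.card_le_card ?_))
      · have h3 : ((Y.filter (· ∈ r₃)).card - 1) ≤ ((Y.filter (· ∈ r₃)).erase P).card :=
          Finset.pred_card_le_card_erase
        refine (Nat.sub_le_sub_right h13.2.2.2.2.1 1).trans (h3.trans (Finset.card_le_card ?_))
        intro Q hQ
        simp only [hZ, Finset.mem_erase, Finset.mem_filter] at hQ ⊢
        exact ⟨⟨hQ.1, hQ.2.1, fun h => h13.2.2.2.2.2 Q hQ.2.1 h hQ.2.2,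
          fun h => h23.2.2.2.2.2 Q hQ.2.1 h hQ.2.2⟩, hQ.2.2⟩
      · intro Q hQ
        obtain ⟨hQP, hQG⟩ := Finset.mem_erase.1 hQ
        have hQ4 := hGr Q hQG
        obtain ⟨hQY, h⟩ := Finset.mem_filter.1 hQG
        simp only [List.nodup_cons, List.mem_cons, List.not_mem_nil, or_false, not_or] at hnd
        simp only [hZ, Finset.mem_erase, Finset.mem_filter]
        exact ⟨⟨hQP, hQY, h _ h12.1 hnd.1.2.2, h _ h12.2.1 hnd.2.1.2⟩, hQ4,
          h _ h13.2.1 hnd.2.2.1⟩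
    obtain ⟨P, S, hP, hPA, hPB, hPG⟩ : ∃ P S, IsStar X l P S ∧ P ≠ A ∧ P ≠ B ∧
        2 ≤ (G.erase P).card := by
      simp only [List.nodup_cons, List.mem_cons, List.not_mem_nil, or_false, not_or] at hne
      by_cases hCG : C ∈ G
      · by_cases hDG : D ∈ G
        · by_cases hEG : E ∈ G
          · refine ⟨C, SC, hC, Ne.symm hne.1.2.1, Ne.symm hne.2.1.1, ?_⟩
            rw [← Finset.card_pair hne.2.2.2.1]
            refine Finset.card_le_card fun Q hQ => ?_
            simp only [Finset.mem_insert, Finset.mem_singleton] at hQ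
            rcases hQ with rfl | rfl
            · exact Finset.mem_erase.2 ⟨Ne.symm hne.2.2.1.1, hDG⟩
            · exact Finset.mem_erase.2 ⟨Ne.symm hne.2.2.1.2, hEG⟩
          · exact ⟨E, SE, hE, Ne.symm hne.1.2.2.2, Ne.symm hne.2.1.2.2,
              by rwa [Finset.erase_eq_of_notMem hEG]⟩
        · exact ⟨D, SD, hD, Ne.symm hne.1.2.2.1, Ne.symm hne.2.1.2.1,
            by rwa [Finset.erase_eq_of_notMem hDG]⟩
      · exact ⟨C, SC, hC, Ne.symm hne.1.2.1, Ne.symm hne.2.1.1,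
          by rwa [Finset.erase_eq_of_notMem hCG]⟩
    have hPY := huser hP hPA hPB
    have hnd' := hnd
    simp only [List.nodup_cons, List.mem_cons, List.not_mem_nil, or_false, not_or] at hnd'
    by_cases hP1 : P ∈ r₁
    · refine key hP hPA hPB hPG h23 (hFsymm h12) (hFsymm h13) ?_ (h12.2.2.2.2.2 P hPY hP1)
        (h13.2.2.2.2.2 P hPY hP1)
      simp only [List.nodup_cons, List.mem_cons, List.not_mem_nil, or_false, not_or]
      grind
    · by_cases hP2 : P ∈ r₂
      · refine key hP hPA hPB hPG h13 h12 (hFsymm h23) ?_ hP1 (h23.2.2.2.2.2 P hPY hP2)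
        simp only [List.nodup_cons, List.mem_cons, List.not_mem_nil, or_false, not_or]
        grind
      · exact key hP hPA hPB hPG h12 h13 h23 hnd hP1 hP2
  have hZle : ∀ {r₁ r₂ r₃}, F r₁ r₂ → r₃ ∈ SA → r₁ ≠ r₃ → r₂ ≠ r₃ →
      ((Z r₁ r₂).filter (· ∈ r₃)).card ≤ 3 := by
    intro r₁ r₂ r₃ h12 hr₃ h13 h23
    by_contra! h
    have h4 : 4 ≤ (Y.filter fun P => P ∈ r₃ ∧ (P ∉ r₁ ∧ P ∉ r₂)).card :=
      (Nat.succ_le_of_lt h).trans (Finset.card_le_card fun P hP => by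
        simp only [hZ, Finset.mem_filter] at hP ⊢
        exact ⟨hP.1.1, hP.2, hP.1.2⟩)
    have hoff₃ := hoff r₃ hr₃ (fun P => P ∉ r₁ ∧ P ∉ r₂) _
      (fun Q hQ => Finset.mem_filter.1 hQ) h4
    have h4' : 4 ≤ (Y.filter (· ∈ r₃)).card := h4.trans (Finset.card_le_card fun P hP => by
      simp only [Finset.mem_filter] at hP ⊢
      exact ⟨hP.1, hP.2.1⟩)
    exact hthree h12 ⟨h12.1, hr₃, h13, h12.2.2.2.1, h4', fun P hP h1 h3 => (hoff₃ P hP h3).1 h1⟩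
      ⟨h12.2.1, hr₃, h23, h12.2.2.2.2.1, h4', fun P hP h2 h3 => (hoff₃ P hP h3).2 h2⟩
  have hZcov : ∀ {r₁ r₂ r₃ r₄}, (∀ s ∈ SA, s = r₁ ∨ s = r₂ ∨ s = r₃ ∨ s = r₄) → ∀ P ∈ Z r₁ r₂,
      P ∈ r₃ ∨ P ∈ r₄ := by
    intro r₁ r₂ r₃ r₄ hcov P hP
    obtain ⟨hPY, hP1, hP2⟩ := Finset.mem_filter.1 hP
    obtain ⟨s, hs, hPs⟩ := hYA P hPY
    rcases hcov s hs with rfl | rfl | rfl | rfl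
    exacts [absurd hPs hP1, absurd hPs hP2, Or.inl hPs, Or.inr hPs]
  have hmemF : ∀ {P S}, IsStar X l P S → P ≠ A → P ≠ B → ∀ {r₁ r₂}, F r₁ r₂ →
      P ∈ r₁ ∨ P ∈ r₂ := by
    intro P S hP hPA hPB r₁ r₂ h12
    by_contra! hPr
    obtain ⟨r₃, hr₃, r₄, hr₄, hnd, hcov⟩ :=
      exists_pair_of_card_eq_four hA.card h12.1 h12.2.1 h12.2.2.1
    have hZ5 : 5 ≤ ((Z r₁ r₂).erase P).card :=
      (Nat.sub_le_sub_right (hZcard r₁ h12.1 r₂ h12.2.1) 1).trans Finset.pred_card_le_card_erase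
    have key : ∀ {r₃ r₄}, r₃ ∈ SA → r₄ ∈ SA → [r₁, r₂, r₃, r₄].Nodup →
        (∀ s ∈ SA, s = r₁ ∨ s = r₂ ∨ s = r₃ ∨ s = r₄) →
        (((Z r₁ r₂).erase P).filter (· ∈ r₃)).card < 3 := by
      intro r₃ r₄ hr₃ hr₄ hnd hcov
      by_contra! h3
      refine htwo hP hPA hPB h12 hr₃ hr₄ hnd hPr.1 hPr.2 h3 ?_
      have hsum : ((Z r₁ r₂).erase P).card ≤ (((Z r₁ r₂).erase P).filter (· ∈ r₃)).card +
          (((Z r₁ r₂).erase P).filter fun Q => Q ∈ r₄ ∧ Q ∉ r₃).card :=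
        card_le_card_add_card fun Q hQ => by
          have := hZcov hcov Q (Finset.mem_of_mem_erase hQ)
          simp only [Finset.mem_filter]
          tauto
      simp only [List.nodup_cons, List.mem_cons, List.not_mem_nil, or_false, not_or] at hnd
      have hle := (Finset.card_le_card (Finset.filter_subset_filter (· ∈ r₃)
        (Finset.erase_subset P (Z r₁ r₂)))).trans (hZle h12 hr₃ hnd.1.2.1 hnd.2.1.1)
      omega
    have hlt3 := key hr₃ hr₄ hnd hcov
    have hlt4 := key hr₄ hr₃ ((List.Perm.nodup_iff (((List.Perm.swap r₄ r₃ []).cons r₂).cons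
      r₁)).1 hnd) fun s hs => by
        have := hcov s hs
        tauto
    have hsum : ((Z r₁ r₂).erase P).card ≤ (((Z r₁ r₂).erase P).filter (· ∈ r₃)).card +
        (((Z r₁ r₂).erase P).filter (· ∈ r₄)).card :=
      card_le_card_add_card fun Q hQ => by
        have := hZcov hcov Q (Finset.mem_of_mem_erase hQ)
        simp only [Finset.mem_filter]
        tauto
    omega
  have htwoRow : ∀ {P Q S S'}, IsStar X l P S → IsStar X l Q S' → [A, B, P, Q].Nodup →
      ∀ ⦃r₁ r₂⦄, F r₁ r₂ → P ∈ r₁ → Q ∈ r₁ → False := by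
    intro P Q S S' hP hQ hnePQ r₁ r₂ h12 hPr hQr
    have hne' := hnePQ
    simp only [List.nodup_cons, List.mem_cons, List.not_mem_nil, or_false, not_or] at hne'
    have hPY := huser hP (Ne.symm hne'.1.2.1) (Ne.symm hne'.2.1.1)
    have hQY := huser hQ (Ne.symm hne'.1.2.2) (Ne.symm hne'.2.1.2)
    obtain ⟨r₃, hr₃, r₄, hr₄, hnd, hcov⟩ :=
      exists_pair_of_card_eq_four hA.card h12.1 h12.2.1 h12.2.2.1
    have hnd' := hnd
    simp only [List.nodup_cons, List.mem_cons, List.not_mem_nil, or_false, not_or] at hnd'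
    have hZ6 := hZcard r₁ h12.1 r₂ h12.2.1
    have hle3 := hZle h12 hr₃ hnd'.1.2.1 hnd'.2.1.1
    have hle4 := hZle h12 hr₄ hnd'.1.2.2 hnd'.2.1.2
    have hsum3 : (Z r₁ r₂).card ≤ ((Z r₁ r₂).filter (· ∈ r₃)).card +
        ((Z r₁ r₂).filter fun Q => Q ∈ r₄ ∧ Q ∉ r₃).card :=
      card_le_card_add_card fun Q hQ => by
        have := hZcov hcov Q hQ
        simp only [Finset.mem_filter]
        tauto
    have hsum4 : (Z r₁ r₂).card ≤ ((Z r₁ r₂).filter (· ∈ r₃)).card +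
        ((Z r₁ r₂).filter (· ∈ r₄)).card :=
      card_le_card_add_card fun Q hQ => by
        have := hZcov hcov Q hQ
        simp only [Finset.mem_filter]
        tauto
    have key : ∀ {r}, r ∈ SA → r₁ ≠ r → r₂ ≠ r → 3 ≤ ((Z r₁ r₂).filter (· ∈ r)).card →
        ∀ R ∈ Y, R ∈ r₁ → R ∉ r := by
      intro r hr h1r h2r h3 R hRY hR1 hRr
      have hR : R ∉ (Z r₁ r₂).filter (· ∈ r) := fun h =>
        (Finset.mem_filter.1 (Finset.mem_filter.1 h).1).2.1 hR1
      have h4 : 4 ≤ (Y.filter fun T => T ∈ r ∧ T ∉ r₂).card := by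
        refine (Nat.succ_le_succ h3).trans ((Finset.card_insert_of_notMem hR).ge.trans
          (Finset.card_le_card fun T hT => ?_))
        simp only [hZ, Finset.mem_insert, Finset.mem_filter] at hT ⊢
        rcases hT with rfl | hT
        · exact ⟨hRY, hRr, h12.2.2.2.2.2 T hRY hR1⟩
        · exact ⟨hT.1.1, hT.2, hT.1.2.2⟩
      have hF2 : F r r₂ := ⟨hr, h12.2.1, h2r.symm, h4.trans (Finset.card_le_card fun T hT => by
        simp only [Finset.mem_filter] at hT ⊢
        exact ⟨hT.1, hT.2.1⟩), h12.2.2.2.2.1,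
        hoff r hr (· ∉ r₂) _ (fun Q hQ => Finset.mem_filter.1 hQ) h4⟩
      have hP' := (hmemF hP (Ne.symm hne'.1.2.1) (Ne.symm hne'.2.1.1) hF2).resolve_right
        (h12.2.2.2.2.2 P hPY hPr)
      have hQ' := (hmemF hQ (Ne.symm hne'.1.2.2) (Ne.symm hne'.2.1.2) hF2).resolve_right
        (h12.2.2.2.2.2 Q hQY hQr)
      exact h1r ((hA.isLine r₁ h12.1).eq_of_mem (hA.isLine r hr) hne'.2.2.1 hPr hQr hP' hQ')
    have h3 : 3 ≤ ((Z r₁ r₂).filter (· ∈ r₃)).card := by omega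
    have h4 : 3 ≤ ((Z r₁ r₂).filter (· ∈ r₄)).card := by omega
    have hkey3 := key hr₃ hnd'.1.2.1 hnd'.2.1.1 h3
    have hkey4 := key hr₄ hnd'.1.2.2 hnd'.2.1.2 h4
    have hmem : ∀ T ∈ Y, T ≠ P → T ≠ Q → T ∈ X ∧ T ∉ l ∧ T ≠ B ∧ T ≠ P ∧ T ≠ Q :=
      fun T hT hTP hTQ => ⟨(hYmem T hT).1, (hYmem T hT).2.1, (hYmem T hT).2.2, hTP, hTQ⟩
    have hZmem : ∀ T ∈ Z r₁ r₂, T ∈ Y ∧ T ∉ r₁ ∧ T ∉ r₂ := fun T hT => Finset.mem_filter.1 hT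
    refine hA.false_of_three hB hP hQ hnePQ h12.2.1 hr₃ hr₄ h12.1 ?_
      (T₁ := Y.filter (· ∈ r₂)) (T₂ := (Z r₁ r₂).filter (· ∈ r₃))
      (T₃ := (Z r₁ r₂).filter fun Q => Q ∈ r₄ ∧ Q ∉ r₃)
      (T₄ := ((Y.filter (· ∈ r₁)).erase P).erase Q) ?_
      (fun T hT => (Finset.mem_filter.1 hT).2)
      (fun T hT => ⟨(Finset.mem_filter.1 hT).2, (hZmem T (Finset.mem_filter.1 hT).1).2.2⟩)
      (fun T hT => ⟨(Finset.mem_filter.1 hT).2.1, (hZmem T (Finset.mem_filter.1 hT).1).2.2,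
        (Finset.mem_filter.1 hT).2.2⟩) ?_ h12.2.2.2.2.1 h3 (by omega) ?_
    · simp only [List.nodup_cons, List.mem_cons, List.not_mem_nil, or_false, not_or]
      grind
    · rintro T (hT | hT | hT | hT)
      · obtain ⟨hTY, hTr⟩ := Finset.mem_filter.1 hT
        exact hmem T hTY (fun h => h12.2.2.2.2.2 P hPY hPr (h ▸ hTr))
          fun h => h12.2.2.2.2.2 Q hQY hQr (h ▸ hTr)
      · obtain ⟨hTY, hT1, -⟩ := hZmem T (Finset.mem_filter.1 hT).1
        exact hmem T hTY (fun h => hT1 (h ▸ hPr)) fun h => hT1 (h ▸ hQr)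
      · obtain ⟨hTY, hT1, -⟩ := hZmem T (Finset.mem_filter.1 hT).1
        exact hmem T hTY (fun h => hT1 (h ▸ hPr)) fun h => hT1 (h ▸ hQr)
      · simp only [Finset.mem_erase, Finset.mem_filter] at hT
        exact hmem T hT.2.2.1 hT.2.1 hT.1
    · intro T hT
      simp only [Finset.mem_erase, Finset.mem_filter] at hT
      obtain ⟨-, -, hTY, hTr⟩ := hT
      exact ⟨hTr, h12.2.2.2.2.2 T hTY hTr, hkey3 T hTY hTr, hkey4 T hTY hTr⟩
    · have h4' := h12.2.2.2.1
      have e1 : (Y.filter (· ∈ r₁)).card - 1 ≤ ((Y.filter (· ∈ r₁)).erase P).card :=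
        Finset.pred_card_le_card_erase
      have e2 : ((Y.filter (· ∈ r₁)).erase P).card - 1 ≤
        (((Y.filter (· ∈ r₁)).erase P).erase Q).card := Finset.pred_card_le_card_erase
      exact (Nat.sub_le_sub_right ((Nat.sub_le_sub_right h4' 1).trans e1) 1).trans e2
  obtain ⟨r₁, r₂, h12⟩ : ∃ r₁ r₂, F r₁ r₂ := by
    obtain ⟨r₁, hr₁, h1⟩ := exists_lt_card_filter_mem hYA (k := 3)
      (by rw [hA.card]; exact Nat.lt_of_lt_of_le (by norm_num) hYcard)
    have hsum : Y.card ≤ (Y.filter (· ∈ r₁)).card + (Y.filter (· ∉ r₁)).card :=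
      card_le_card_add_card fun P hP => by
        simp only [Finset.mem_filter]
        tauto
    have hle := hrow r₁ hr₁
    obtain ⟨r₂, hr₂, h2⟩ := exists_lt_card_filter_mem (Y := Y.filter (· ∉ r₁)) (S := SA.erase r₁)
      (k := 3)
      (fun P hP => by
        obtain ⟨hPY, hPr⟩ := Finset.mem_filter.1 hP
        obtain ⟨s, hs, hPs⟩ := hYA P hPY
        exact ⟨s, Finset.mem_erase.2 ⟨fun h => hPr (h ▸ hPs), hs⟩, hPs⟩)
      (by rw [Finset.card_erase_of_mem hr₁, hA.card]; omega)
    obtain ⟨hr₂₁, hr₂⟩ := Finset.mem_erase.1 hr₂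
    have h4 : 4 ≤ (Y.filter fun P => P ∈ r₂ ∧ P ∉ r₁).card :=
      (Nat.succ_le_of_lt h2).trans (Finset.card_le_card fun P hP => by
        simp only [Finset.mem_filter] at hP ⊢
        exact ⟨hP.1.1, hP.2, hP.1.2⟩)
    refine ⟨r₂, r₁, hr₂, hr₁, hr₂₁, h4.trans (Finset.card_le_card fun T hT => ?_), h1,
      hoff r₂ hr₂ (· ∉ r₁) _ (fun Q hQ => Finset.mem_filter.1 hQ) h4⟩
    simp only [Finset.mem_filter] at hT ⊢
    exact ⟨hT.1, hT.2.1⟩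
  have hne' := hne
  simp only [List.nodup_cons, List.mem_cons, List.not_mem_nil, or_false, not_or] at hne'
  have hCr := hmemF hC (Ne.symm hne'.1.2.1) (Ne.symm hne'.2.1.1) h12
  have hDr := hmemF hD (Ne.symm hne'.1.2.2.1) (Ne.symm hne'.2.1.2.1) h12
  have hEr := hmemF hE (Ne.symm hne'.1.2.2.2) (Ne.symm hne'.2.1.2.2) h12
  have hCD := htwoRow hC hD (by simp; tauto)
  have hCE := htwoRow hC hE (by simp; tauto)
  have hDE := htwoRow hD hE (by simp; tauto)
  rcases hCr with c | c <;> rcases hDr with d | d <;> rcases hEr with e | e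
  exacts [hCD h12 c d, hCD h12 c d, hCE h12 c e, hDE (hFsymm h12) d e, hDE h12 d e,
    hCE (hFsymm h12) c e, hCD (hFsymm h12) c d, hCD (hFsymm h12) c d]

/-- If five nodes have stars with base line `l`, then some two lines contain, together with `l`,
all but at most six nodes. -/
lemma exists_lines_of_isStar (hX : X.card = 21)
    (h5 : ∀ s, IsLine s → (X.filter (· ∈ s)).card ≤ 5) (hl : IsLine l) {A B C D E : ℝ × ℝ}
    {SA SB SC SD SE : Finset (Set (ℝ × ℝ))} (hA : IsStar X l A SA) (hB : IsStar X l B SB)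
    (hC : IsStar X l C SC) (hD : IsStar X l D SD) (hE : IsStar X l E SE)
    (hne : [A, B, C, D, E].Nodup) :
    ∃ x y, IsLine x ∧ IsLine y ∧ (X.filter fun P => P ∉ l ∧ P ∉ x ∧ P ∉ y).card ≤ 6 := by
  by_contra hgoal
  have hnd : [A, C, B, D, E].Nodup ∧ [A, D, B, C, E].Nodup ∧ [A, E, B, C, D].Nodup ∧ [A, B, D, C,
      E].Nodup ∧ [A, B, E, C, D].Nodup ∧ [A, C, D, B, E].Nodup ∧ [A, C, E, B, D].Nodup ∧ [A, D, E,
      B, C].Nodup ∧ [A, C, D, E].Nodup ∧ [A, B, D, E].Nodup ∧ [A, B, C, E].Nodup ∧ [A, B, C,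
      D].Nodup := by
    clear * - hne
    simp only [List.nodup_cons, List.mem_cons, List.not_mem_nil, or_false, not_or] at hne ⊢
    grind
  obtain ⟨hCBDE, hDBCE, hEBCD, hBDCE, hBECD, hCDBE, hCEBD, hDEBC, hCDE, hBDE, hBCE, hBCD⟩ := hnd
  have key : ∀ {P Q R T SP SQ SR ST}, IsStar X l P SP → IsStar X l Q SQ → IsStar X l R SR →
      IsStar X l T ST → [A, P, Q, R, T].Nodup → (SA ∩ SP).card = 1 ∨ (SA ∩ SP).card = 3 := by
    intro P Q R T SP SQ SR ST hP hQ hR hT hnd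
    have hle : (SA ∩ SP).card ≤ 4 := (Finset.card_le_card Finset.inter_subset_left).trans hA.card.le
    have h0 : (SA ∩ SP).card ≠ 0 := fun h => hA.false_of_disjoint hX h5 hl hP hQ hR hT hnd h
    have h2 : (SA ∩ SP).card ≠ 2 := fun h => hgoal (hA.exists_of_card_inter_eq_two hP h)
    have h4 : (SA ∩ SP).card ≠ 4 := fun h => by
      have e1 := Finset.eq_of_subset_of_card_le
        (Finset.inter_subset_left (s₁ := SA) (s₂ := SP)) (by rw [hA.card, h])
      have e2 := Finset.eq_of_subset_of_card_le
        (Finset.inter_subset_right (s₁ := SA) (s₂ := SP)) (by rw [hP.card, h])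
      simp only [List.nodup_cons, List.mem_cons, List.not_mem_nil, or_false, not_or] at hnd
      exact hA.ne_of_ne hP hnd.1.1 (e1.symm.trans e2)
    omega
  have three : ∀ {P Q R SP SQ SR}, IsStar X l P SP → IsStar X l Q SQ → IsStar X l R SR →
      [A, P, Q, R].Nodup → (SA ∩ SP).card = 3 → (SA ∩ SQ).card = 3 → (SA ∩ SR).card = 3 →
      False := by
    intro P Q R SP SQ SR hP hQ hR hnd h1 h2 h3
    have hnd' := hnd
    simp only [List.nodup_cons, List.mem_cons, List.not_mem_nil, or_false, not_or] at hnd'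
    by_cases hPQ : SA ∩ SP = SA ∩ SQ
    · by_cases hPR : SA ∩ SP = SA ∩ SR
      · exact hA.false_of_inter_eq hP hQ hR hnd h1 hPQ hPR
      · exact hgoal (hA.exists_of_inter_ne hP hR (Ne.symm hnd'.2.1.2) h1 h3 hPR)
    · exact hgoal (hA.exists_of_inter_ne hP hQ (Ne.symm hnd'.2.1.1) h1 h2 hPQ)
  have hB' := key hB hC hD hE hne
  have hC' := key hC hB hD hE hCBDE
  have hD' := key hD hB hC hE hDBCE
  have hE' := key hE hB hC hD hEBCD
  have one := fun {P Q R T SP SQ SR ST} (hP : IsStar X l P SP) (hQ : IsStar X l Q SQ)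
    (hR : IsStar X l R SR) (hT : IsStar X l T ST) =>
    hA.false_of_card_inter_eq_one hX h5 hl hP hQ hR hT
  rcases hB' with b | b
  · rcases hC' with c | c
    · exact one hB hC hD hE hne b c
    rcases hD' with d | d
    · exact one hB hD hC hE hBDCE b d
    rcases hE' with e | e
    · exact one hB hE hC hD hBECD b e
    exact three hC hD hE hCDE c d e
  rcases hC' with c | c
  · rcases hD' with d | d
    · exact one hC hD hB hE hCDBE c d
    rcases hE' with e | e
    · exact one hC hE hB hD hCEBD c e
    exact three hB hD hE hBDE b d e
  rcases hD' with d | d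
  · rcases hE' with e | e
    · exact one hD hE hB hC hDEBC d e
    exact three hB hC hE hBCE b c e
  exact three hB hC hD hBCD b c d

/-! ### Three disjoint five-node lines -/

/-- Each of the lines `l`, `m₁`, `m₂` contains five of the nodes `X`, no node is on two of them, and
`R` is the set of the six remaining nodes. -/
structure IsTriple (X R : Finset (ℝ × ℝ)) (l m₁ m₂ : MvPolynomial (Fin 2) ℝ) : Prop where
  isLinePoly : IsLinePoly l
  isLinePoly₁ : IsLinePoly m₁
  isLinePoly₂ : IsLinePoly m₂
  card : (X.filter (· ∈ lineSet l)).card = 5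
  card₁ : (X.filter (· ∈ lineSet m₁)).card = 5
  card₂ : (X.filter (· ∈ lineSet m₂)).card = 5
  notMem₁ : ∀ P ∈ X, P ∈ lineSet l → P ∉ lineSet m₁
  notMem₂ : ∀ P ∈ X, P ∈ lineSet l → P ∉ lineSet m₂
  notMem₁₂ : ∀ P ∈ X, P ∈ lineSet m₁ → P ∉ lineSet m₂
  card_rest : R.card = 6
  mem_rest : ∀ P, P ∈ R ↔ P ∈ X ∧ P ∉ lineSet l ∧ P ∉ lineSet m₁ ∧ P ∉ lineSet m₂

lemma IsTriple.swap {X R : Finset (ℝ × ℝ)} {l m₁ m₂ : MvPolynomial (Fin 2) ℝ}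
    (h : IsTriple X R l m₁ m₂) : IsTriple X R l m₂ m₁ :=
  ⟨h.isLinePoly, h.isLinePoly₂, h.isLinePoly₁, h.card, h.card₂, h.card₁, h.notMem₂, h.notMem₁,
    fun P hP h2 h1 => h.notMem₁₂ P hP h1 h2, h.card_rest, fun P => by rw [h.mem_rest]; tauto⟩

lemma isTriple_of_card_le {X : Finset (ℝ × ℝ)} {l m₁ m₂ : MvPolynomial (Fin 2) ℝ}
    (hX : X.card = 21) (h5 : ∀ s, IsLine s → (X.filter (· ∈ s)).card ≤ 5) (hl : IsLinePoly l)
    (hm₁ : IsLinePoly m₁) (hm₂ : IsLinePoly m₂)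
    (h6 : (X.filter fun P => P ∉ lineSet l ∧ P ∉ lineSet m₁ ∧ P ∉ lineSet m₂).card ≤ 6) :
    IsTriple X (X.filter fun P => P ∉ lineSet l ∧ P ∉ lineSet m₁ ∧ P ∉ lineSet m₂) l m₁ m₂ := by
  set R := X.filter fun P => P ∉ lineSet l ∧ P ∉ lineSet m₁ ∧ P ∉ lineSet m₂ with hR
  set M₁ := X.filter fun P => P ∈ lineSet m₁ ∧ P ∉ lineSet l with hM₁
  set M₂ := X.filter fun P => P ∈ lineSet m₂ ∧ P ∉ lineSet l ∧ P ∉ lineSet m₁ with hM₂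
  have hsum : X.card ≤ (X.filter (· ∈ lineSet l)).card + (M₁.card + (M₂.card + R.card)) := by
    refine (card_le_card_add_card (Y₂ := M₁ ∪ (M₂ ∪ R)) fun P hP => ?_).trans
      (add_le_add_right ((Finset.card_union_le _ _).trans
        (add_le_add_right (Finset.card_union_le _ _) _)) _)
    simp only [hR, hM₁, hM₂, Finset.mem_union, Finset.mem_filter]
    tauto
  have hs₁ : M₁ ⊆ X.filter (· ∈ lineSet m₁) := fun P hP => by
    simp only [hM₁, Finset.mem_filter] at hP ⊢
    tauto
  have hs₂ : M₂ ⊆ X.filter (· ∈ lineSet m₂) := fun P hP => by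
    simp only [hM₂, Finset.mem_filter] at hP ⊢
    tauto
  have hc₁ := Finset.card_le_card hs₁
  have hc₂ := Finset.card_le_card hs₂
  have h5l := h5 _ hl.isLine
  have h5₁ := h5 _ hm₁.isLine
  have h5₂ := h5 _ hm₂.isLine
  have e₁ := Finset.eq_of_subset_of_card_le hs₁ (by omega)
  have e₂ := Finset.eq_of_subset_of_card_le hs₂ (by omega)
  have mem₁ : ∀ P ∈ X, P ∈ lineSet m₁ → P ∉ lineSet l := fun P hP hPm => by
    have : P ∈ M₁ := e₁ ▸ Finset.mem_filter.2 ⟨hP, hPm⟩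
    exact (Finset.mem_filter.1 this).2.2
  have mem₂ : ∀ P ∈ X, P ∈ lineSet m₂ → P ∉ lineSet l ∧ P ∉ lineSet m₁ := fun P hP hPm => by
    have : P ∈ M₂ := e₂ ▸ Finset.mem_filter.2 ⟨hP, hPm⟩
    exact (Finset.mem_filter.1 this).2.2
  exact ⟨hl, hm₁, hm₂, by omega, by omega, by omega, fun P hP h h' => mem₁ P hP h' h,
    fun P hP h h' => (mem₂ P hP h').1 h, fun P hP h h' => (mem₂ P hP h').2 h, by omega,
    fun P => Finset.mem_filter⟩

lemma IsTriple.poised {X R : Finset (ℝ × ℝ)} {l m₁ m₂ : MvPolynomial (Fin 2) ℝ}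
    (h : IsTriple X R l m₁ m₂) (hX : Poised 5 (X : Set (ℝ × ℝ))) :
    Poised 2 (R : Set (ℝ × ℝ)) := by
  refine ⟨R.finite_toSet, by rw [Set.ncard_coe_finset, h.card_rest], fun p hp hpR => ?_⟩
  have h0 : l * (m₁ * (m₂ * p)) = 0 := by
    apply hX.2.2
    · refine (totalDegree_mul _ _).trans ?_
      have h1 := totalDegree_mul m₁ (m₂ * p)
      have h2 := totalDegree_mul m₂ p
      have e0 : l.totalDegree = 1 := h.isLinePoly
      have e1 : m₁.totalDegree = 1 := h.isLinePoly₁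
      have e2 : m₂.totalDegree = 1 := h.isLinePoly₂
      omega
    · intro P hP
      simp only [ev_mul, mul_eq_zero]
      by_contra! hP'
      exact hP'.2.2.2 (hpR P ((h.mem_rest P).2 ⟨hP, hP'.1, hP'.2.1, hP'.2.2.1⟩))
  simpa [h.isLinePoly.ne_zero, h.isLinePoly₁.ne_zero, h.isLinePoly₂.ne_zero] using h0

/-- Every node of a 2-poised set has a fundamental polynomial. -/
lemma Poised.exists_isFund {R : Finset (ℝ × ℝ)} (hR : Poised 2 (R : Set (ℝ × ℝ))) {A : ℝ × ℝ}
    (hA : A ∈ R) : ∃ p, IsFund 2 (R : Set (ℝ × ℝ)) A p := by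
  set q : (Fin 6 → ℝ) → MvPolynomial (Fin 2) ℝ := fun v =>
    C (v 0) + C (v 1) * X 0 + C (v 2) * X 1 + C (v 3) * (X 0 * X 0) + C (v 4) * (X 0 * X 1) +
      C (v 5) * (X 1 * X 1) with hq
  have hdeg v : (q v).totalDegree ≤ 2 := by
    have h0 (c : ℝ) : (C c : MvPolynomial (Fin 2) ℝ).totalDegree ≤ 2 := by simp
    have h1 (c : ℝ) (i : Fin 2) : (C c * X i : MvPolynomial (Fin 2) ℝ).totalDegree ≤ 2 :=
      (totalDegree_mul _ _).trans (by simp)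
    have h2 (c : ℝ) (i j : Fin 2) :
        (C c * (X i * X j) : MvPolynomial (Fin 2) ℝ).totalDegree ≤ 2 :=
      (totalDegree_mul _ _).trans (by
        rw [totalDegree_C, zero_add]
        exact (totalDegree_mul (X i : MvPolynomial (Fin 2) ℝ) (X j)).trans (by simp))
    have hadd {a b : MvPolynomial (Fin 2) ℝ} (ha : a.totalDegree ≤ 2) (hb : b.totalDegree ≤ 2) :
        (a + b).totalDegree ≤ 2 := (totalDegree_add _ _).trans (max_le ha hb)
    exact hadd (hadd (hadd (hadd (hadd (h0 _) (h1 _ _)) (h1 _ _)) (h2 _ _ _)) (h2 _ _ _)) (h2 _ _ _)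
  have hev (v : Fin 6 → ℝ) (P : ℝ × ℝ) : ev (q v) P =
      v 0 + v 1 * P.1 + v 2 * P.2 + v 3 * (P.1 * P.1) +
      v 4 * (P.1 * P.2) + v 5 * (P.2 * P.2) := by
    simp [hq, ev]
  set φ : (Fin 6 → ℝ) →ₗ[ℝ] (R → ℝ) :=
    { toFun := fun v P => ev (q v) P
      map_add' := fun v w => by
        funext P
        simp only [hev, Pi.add_apply]
        ring
      map_smul' := fun c v => by
        funext P
        simp only [hev, Pi.smul_apply, smul_eq_mul, RingHom.id_apply]
        ring } with hφ
  have hinj : Function.Injective φ := by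
    rw [← LinearMap.ker_eq_bot, LinearMap.ker_eq_bot']
    intro v hv
    have h0 := hR.2.2 (q v) (hdeg v) fun P hP => congrFun hv ⟨P, hP⟩
    have hz (P : ℝ × ℝ) : v 0 + v 1 * P.1 + v 2 * P.2 + v 3 * (P.1 * P.1) +
        v 4 * (P.1 * P.2) + v 5 * (P.2 * P.2) = 0 := by
      rw [← hev, h0]
      simp [ev]
    have a0 := hz (0, 0)
    have a1 := hz (1, 0)
    have a2 := hz (-1, 0)
    have a3 := hz (0, 1)
    have a4 := hz (0, -1)
    have a5 := hz (1, 1)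
    norm_num at a0 a1 a2 a3 a4 a5
    funext i
    fin_cases i <;> simp <;> linarith
  have hcard : R.card = 6 := by
    rw [← Set.ncard_coe_finset, hR.2.1]
  have hsurj : Function.Surjective φ :=
    (LinearMap.injective_iff_surjective_of_finrank_eq_finrank (by simp [hcard])).1 hinj
  obtain ⟨v, hv⟩ := hsurj (Pi.single ⟨A, hA⟩ 1)
  refine ⟨q v, hdeg v, ?_, fun B hB hBA => ?_⟩
  · exact (congrFun hv ⟨A, hA⟩).trans (Pi.single_eq_same _ _)
  · have := congrFun hv ⟨B, hB⟩
    rwa [Pi.single_eq_of_ne (fun h => hBA (congrArg Subtype.val h))] at this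

/-- The fundamental conics of the nodes off a triple of lines give fundamental polynomials. -/
lemma IsTriple.exists_isFund {X R : Finset (ℝ × ℝ)} {l m₁ m₂ : MvPolynomial (Fin 2) ℝ}
    (h : IsTriple X R l m₁ m₂) {D : ℝ × ℝ} (hD : D ∈ R) {r : MvPolynomial (Fin 2) ℝ}
    (hr : IsFund 2 (R : Set (ℝ × ℝ)) D r) :
    ∃ c : ℝ, c ≠ 0 ∧ IsFund 5 (X : Set (ℝ × ℝ)) D (C c * (l * (m₁ * (m₂ * r)))) := by
  obtain ⟨hDX, h0, h1, h2⟩ := (h.mem_rest D).1 hD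
  have h0' : ev l D ≠ 0 := h0
  have h1' : ev m₁ D ≠ 0 := h1
  have h2' : ev m₂ D ≠ 0 := h2
  refine ⟨(ev l D * (ev m₁ D * ev m₂ D))⁻¹, by positivity, ?_, ?_, ?_⟩
  · have d := totalDegree_mul (C (ev l D * (ev m₁ D * ev m₂ D))⁻¹) (l * (m₁ * (m₂ * r)))
    have d0 := totalDegree_mul l (m₁ * (m₂ * r))
    have d1 := totalDegree_mul m₁ (m₂ * r)
    have d2 := totalDegree_mul m₂ r
    have e0 : l.totalDegree = 1 := h.isLinePoly
    have e1 : m₁.totalDegree = 1 := h.isLinePoly₁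
    have e2 : m₂.totalDegree = 1 := h.isLinePoly₂
    have e3 := hr.1
    rw [totalDegree_C] at d
    omega
  · simp only [ev_mul, ev_C, hr.2.1]
    field_simp
  · intro P hP hPD
    simp only [ev_mul, mul_eq_zero]
    by_contra! hP'
    exact hP'.2.2.2.2 (hr.2.2 P ((h.mem_rest P).2 ⟨hP, hP'.2.1, hP'.2.2.1, hP'.2.2.2.1⟩) hPD)

lemma IsTriple.notMem_of_uses {X R : Finset (ℝ × ℝ)} {l m₁ m₂ : MvPolynomial (Fin 2) ℝ}
    (h : IsTriple X R l m₁ m₂) {D : ℝ × ℝ} (hDX : D ∈ X)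
    (hu : Uses 5 (X : Set (ℝ × ℝ)) D l) : D ∉ lineSet m₁ := by
  intro hDm
  obtain ⟨p, hp, q, rfl⟩ := hu
  have hne : ∀ {f : MvPolynomial (Fin 2) ℝ}, ev f D ≠ 0 → f ≠ 0 := fun {f} hf h => by
    apply hf
    rw [h]
    simp [ev]
  have h1 := hp.2.1
  have hq : ev q D ≠ 0 := fun h0 => by
    rw [ev_mul, h0, mul_zero] at h1
    exact zero_ne_one h1
  have hdq : q.totalDegree ≤ 4 := by
    have := hp.1
    rw [totalDegree_mul_of_isDomain h.isLinePoly.ne_zero (hne hq), h.isLinePoly] at this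
    omega
  have hqz : ∀ P ∈ X, P ∉ lineSet l → P ≠ D → ev q P = 0 := fun P hP hPl hPD => by
    have := hp.2.2 P hP hPD
    rw [ev_mul] at this
    exact (mul_eq_zero.1 this).resolve_left hPl
  obtain ⟨g, rfl⟩ : m₂ ∣ q := by
    apply h.isLinePoly₂.dvd_of_vanish (X.filter (· ∈ lineSet m₂))
    · exact fun P hP => (Finset.mem_filter.1 hP).2
    · intro P hP
      obtain ⟨hPX, hP2⟩ := Finset.mem_filter.1 hP
      exact hqz P hPX (fun hPl => h.notMem₂ P hPX hPl hP2)
        fun hPD => h.notMem₁₂ D hDX hDm (hPD ▸ hP2)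
    · rw [h.card₂]
      omega
  rw [ev_mul] at hq
  have hg := right_ne_zero_of_mul hq
  have hdg : g.totalDegree ≤ 3 := by
    rw [totalDegree_mul_of_isDomain h.isLinePoly₂.ne_zero (hne hg), h.isLinePoly₂] at hdq
    omega
  refine hg (ev_eq_zero_of_dvd (l := m₁) ?_ hDm)
  apply h.isLinePoly₁.dvd_of_vanish ((X.filter (· ∈ lineSet m₁)).erase D)
  · exact fun P hP => (Finset.mem_filter.1 (Finset.mem_of_mem_erase hP)).2
  · intro P hP
    obtain ⟨hPD, hP'⟩ := Finset.mem_erase.1 hP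
    obtain ⟨hPX, hP1⟩ := Finset.mem_filter.1 hP'
    have := hqz P hPX (fun hPl => h.notMem₁ P hPX hPl hP1) hPD
    rw [ev_mul] at this
    exact (mul_eq_zero.1 this).resolve_left (h.notMem₁₂ P hPX hP1)
  · rw [Finset.card_erase_of_mem (Finset.mem_filter.2 ⟨hDX, hDm⟩), h.card₁]
    omega

lemma IsTriple.mem_of_uses {X R : Finset (ℝ × ℝ)} {l m₁ m₂ : MvPolynomial (Fin 2) ℝ}
    (h : IsTriple X R l m₁ m₂) {D : ℝ × ℝ} (hDX : D ∈ X)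
    (hu : Uses 5 (X : Set (ℝ × ℝ)) D l) : D ∈ R := by
  refine (h.mem_rest D).2 ⟨hDX, fun hDl => ?_, h.notMem_of_uses hDX hu,
    h.swap.notMem_of_uses hDX hu⟩
  obtain ⟨p, hp, hlp⟩ := hu
  have h1 := hp.2.1
  rw [ev_eq_zero_of_dvd hlp hDl] at h1
  exact zero_ne_one h1

lemma IsTriple.uses {X R : Finset (ℝ × ℝ)} {l m₁ m₂ : MvPolynomial (Fin 2) ℝ}
    (h : IsTriple X R l m₁ m₂) (hX : Poised 5 (X : Set (ℝ × ℝ))) {D : ℝ × ℝ} (hD : D ∈ R) :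
    Uses 5 (X : Set (ℝ × ℝ)) D l ∧ Uses 5 (X : Set (ℝ × ℝ)) D m₁ ∧
      Uses 5 (X : Set (ℝ × ℝ)) D m₂ := by
  obtain ⟨r, hr⟩ := (h.poised hX).exists_isFund hD
  obtain ⟨c, -, hp⟩ := h.exists_isFund hD hr
  exact ⟨⟨_, hp, C c * (m₁ * (m₂ * r)), by ring⟩, ⟨_, hp, C c * (l * (m₂ * r)), by ring⟩,
    ⟨_, hp, C c * (l * (m₁ * r)), by ring⟩⟩

lemma IsLinePoly.C_mul {l : MvPolynomial (Fin 2) ℝ} (hl : IsLinePoly l) {c : ℝ} (hc : c ≠ 0) :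
    IsLinePoly (C c * l) := by
  have hc' : (C c : MvPolynomial (Fin 2) ℝ) ≠ 0 := by simpa using hc
  rw [IsLinePoly, totalDegree_mul_of_isDomain hc' hl.ne_zero, totalDegree_C, zero_add]
  exact hl

lemma IsTriple.exists_mul {X R : Finset (ℝ × ℝ)} {l m₁ m₂ : MvPolynomial (Fin 2) ℝ}
    (h : IsTriple X R l m₁ m₂) (hX : GCSet 5 (X : Set (ℝ × ℝ))) {D : ℝ × ℝ} (hD : D ∈ R) :
    ∃ g₁ g₂, IsLinePoly g₁ ∧ IsLinePoly g₂ ∧ IsFund 2 (R : Set (ℝ × ℝ)) D (g₁ * g₂) := by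
  obtain ⟨r, hr⟩ := (h.poised hX.1).exists_isFund hD
  obtain ⟨c, hc, hp⟩ := h.exists_isFund hD hr
  obtain ⟨q, hq, f, hf, rfl⟩ := hX.2 D ((h.mem_rest D).1 hD).1
  obtain ⟨c₁, hc₁, f₁, hf₁, e₁⟩ := exists_prod_of_mul_eq_prod (c := 1)
    (g := m₁ * (m₂ * (C c * r))) h.isLinePoly one_ne_zero hf (by
      rw [← hp.unique hX.1 hq, C_1]
      ring)
  obtain ⟨c₂, hc₂, f₂, hf₂, e₂⟩ := exists_prod_of_mul_eq_prod h.isLinePoly₁ hc₁ hf₁ e₁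
  obtain ⟨c₃, hc₃, f₃, hf₃, e₃⟩ := exists_prod_of_mul_eq_prod h.isLinePoly₂ hc₂ hf₂ e₂
  refine ⟨C (c⁻¹ * c₃) * f₃ 0, f₃ 1, (hf₃ 0).C_mul (by positivity), hf₃ 1, ?_⟩
  convert hr using 1
  have hcr : r = C c⁻¹ * (C c * r) := by
    rw [← mul_assoc, ← C_mul, inv_mul_cancel₀ hc, C_1, one_mul]
  rw [hcr, e₃, Fin.prod_univ_two, C_mul]
  ring

lemma IsTriple.gcSet {X R : Finset (ℝ × ℝ)} {l m₁ m₂ : MvPolynomial (Fin 2) ℝ}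
    (h : IsTriple X R l m₁ m₂) (hX : GCSet 5 (X : Set (ℝ × ℝ))) : GCSet 2 (R : Set (ℝ × ℝ)) := by
  refine ⟨h.poised hX.1, fun D hD => ?_⟩
  obtain ⟨g₁, g₂, h₁, h₂, hg⟩ := h.exists_mul hX hD
  exact ⟨_, hg, ![g₁, g₂], by simp [Fin.forall_fin_two, h₁, h₂], by simp⟩

/-! ### Primary nodes -/

lemma resCount_coe (X : Finset (ℝ × ℝ)) (L : Fin 5 → MvPolynomial (Fin 2) ℝ) (s : Fin 5)
    (p : MvPolynomial (Fin 2) ℝ) : resCount (X : Set (ℝ × ℝ)) L s p =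
      (X.filter fun P => P ∈ lineSet p ∧ ∀ i, i < s → P ∉ lineSet (L i)).card := by
  rw [← Set.ncard_coe_finset, Finset.coe_filter]
  rfl

lemma resCount_le (X : Finset (ℝ × ℝ)) (L : Fin 5 → MvPolynomial (Fin 2) ℝ) (s : Fin 5)
    (p : MvPolynomial (Fin 2) ℝ) :
    resCount (X : Set (ℝ × ℝ)) L s p ≤ (X.filter (· ∈ lineSet p)).card := by
  rw [resCount_coe]
  exact Finset.card_le_card (Finset.monotone_filter_right _ fun P _ hP => hP.1)

lemma lineSet_ne_of_resCount_ne_zero {X : Set (ℝ × ℝ)} {L : Fin 5 → MvPolynomial (Fin 2) ℝ}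
    {i j : Fin 5} (hij : i < j) (h : resCount X L j (L j) ≠ 0) : lineSet (L i) ≠ lineSet (L j) := by
  obtain ⟨P, -, hP, hi⟩ := Set.nonempty_of_ncard_ne_zero h
  exact fun e => hi i hij (e.symm ▸ hP : P ∈ lineSet (L i))

/-- The fundamental conic of a node off a triple of lines splits into a line with three nodes and a
line with two primary nodes. -/
lemma IsTriple.exists_mul_card {X R : Finset (ℝ × ℝ)} {l m₁ m₂ : MvPolynomial (Fin 2) ℝ}
    (h : IsTriple X R l m₁ m₂) (hX : GCSet 5 (X : Set (ℝ × ℝ))) {D : ℝ × ℝ} (hD : D ∈ R) :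
    ∃ g₁ g₂, IsLinePoly g₁ ∧ IsLinePoly g₂ ∧ IsFund 2 (R : Set (ℝ × ℝ)) D (g₁ * g₂) ∧
      (R.filter (· ∈ lineSet g₁)).card = 3 ∧
      (R.filter fun P => P ∈ lineSet g₂ ∧ P ∉ lineSet g₁).card = 2 := by
  obtain ⟨g₁, g₂, h₁, h₂, hg⟩ := h.exists_mul hX hD
  have hle {g : MvPolynomial (Fin 2) ℝ} (hg : IsLinePoly g) :
      (R.filter (· ∈ lineSet g)).card ≤ 3 := (h.gcSet hX).card_filter_mem_le hg.isLine
  have hsum {g₁ g₂ : MvPolynomial (Fin 2) ℝ} (hg : IsFund 2 (R : Set (ℝ × ℝ)) D (g₁ * g₂)) :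
      (R.filter (· ∈ lineSet g₁)).card +
        (R.filter fun P => P ∈ lineSet g₂ ∧ P ∉ lineSet g₁).card = 5 := by
    rw [← Finset.card_union_of_disjoint]
    · have : 5 = (R.erase D).card := by rw [Finset.card_erase_of_mem hD, h.card_rest]
      rw [this]
      congr 1
      ext P
      simp only [Finset.mem_union, Finset.mem_filter, Finset.mem_erase]
      constructor
      · intro hP
        refine ⟨?_, by tauto⟩
        rintro rfl
        have h1 := hg.2.1
        rw [ev_mul] at h1
        rcases hP with hP | hP
        · rw [show ev g₁ P = 0 from hP.2, zero_mul] at h1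
          exact zero_ne_one h1
        · rw [show ev g₂ P = 0 from hP.2.1, mul_zero] at h1
          exact zero_ne_one h1
      · rintro ⟨hPD, hP⟩
        have h1 := hg.2.2 P hP hPD
        rw [ev_mul, mul_eq_zero] at h1
        have : P ∈ lineSet g₁ ∨ P ∈ lineSet g₂ := h1
        tauto
    · rw [Finset.disjoint_left]
      simp only [Finset.mem_filter]
      tauto
  wlog h3 : (R.filter (· ∈ lineSet g₁)).card = 3 generalizing g₁ g₂
  · refine this g₂ g₁ h₂ h₁ (mul_comm g₁ g₂ ▸ hg) ?_
    have h5 := hsum hg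
    have hle₁ := hle h₁
    have hle₂ := hle h₂
    have hmono := Finset.card_le_card (s := R.filter fun P => P ∈ lineSet g₂ ∧ P ∉ lineSet g₁)
      (t := R.filter (· ∈ lineSet g₂)) (Finset.monotone_filter_right _ fun P _ hP => hP.1)
    omega
  · have h5 := hsum hg
    exact ⟨g₁, g₂, h₁, h₂, hg, h3, by omega⟩

lemma IsTriple.hasMDSeq {X R : Finset (ℝ × ℝ)} {l m₁ m₂ : MvPolynomial (Fin 2) ℝ}
    (h : IsTriple X R l m₁ m₂) (hX : GCSet 5 (X : Set (ℝ × ℝ)))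
    (h5 : ∀ s, IsLine s → (X.filter (· ∈ s)).card ≤ 5) {D : ℝ × ℝ} (hD : D ∈ R) :
    HasMDSeq (X : Set (ℝ × ℝ)) D ![5, 5, 5, 3, 2] := by
  obtain ⟨g₁, g₂, hg₁, hg₂, hg, hc₁, hc₂⟩ := h.exists_mul_card hX hD
  have hle : (R.filter (· ∈ lineSet g₂)).card ≤ 3 := (h.gcSet hX).card_filter_mem_le hg₂.isLine
  set L : Fin 5 → MvPolynomial (Fin 2) ℝ := ![l, m₁, m₂, g₁, g₂] with hL
  have hline : ∀ i, IsLinePoly (L i) := by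
    simp [hL, Fin.forall_fin_succ, h.isLinePoly, h.isLinePoly₁, h.isLinePoly₂, hg₁, hg₂]
  have hthree (p : MvPolynomial (Fin 2) ℝ) :
      resCount (X : Set (ℝ × ℝ)) L 3 p = (R.filter (· ∈ lineSet p)).card := by
    rw [resCount_coe]
    congr 1
    ext P
    simp [hL, Fin.forall_fin_succ, h.mem_rest]
    tauto
  have h0 : resCount (X : Set (ℝ × ℝ)) L 0 l = 5 := by
    rw [resCount_coe]
    refine (congrArg Finset.card ?_).trans h.card
    ext P
    simp
  have h1 : resCount (X : Set (ℝ × ℝ)) L 1 m₁ = 5 := by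
    rw [resCount_coe]
    refine (congrArg Finset.card ?_).trans h.card₁
    ext P
    have := h.notMem₁ P
    simp [hL]
    tauto
  have h2 : resCount (X : Set (ℝ × ℝ)) L 2 m₂ = 5 := by
    rw [resCount_coe]
    refine (congrArg Finset.card ?_).trans h.card₂
    ext P
    have := h.notMem₂ P
    have := h.notMem₁₂ P
    simp [hL, Fin.forall_fin_succ]
    tauto
  have h3 : resCount (X : Set (ℝ × ℝ)) L 3 g₁ = 3 := by rw [hthree, hc₁]
  have h4 : resCount (X : Set (ℝ × ℝ)) L 4 g₂ = 2 := by
    rw [resCount_coe]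
    refine (congrArg Finset.card ?_).trans hc₂
    ext P
    simp [hL, Fin.forall_fin_succ, h.mem_rest]
    tauto
  have hres : ∀ s, resCount (X : Set (ℝ × ℝ)) L s (L s) = ![5, 5, 5, 3, 2] s := by
    intro s
    fin_cases s
    exacts [h0, h1, h2, h3, h4]
  have hpos s : resCount (X : Set (ℝ × ℝ)) L s (L s) ≠ 0 := by
    rw [hres]
    fin_cases s <;> simp
  refine ⟨L, ⟨hline, fun i j hij => ?_, ?_, fun s t hst => ?_⟩, hres⟩
  · rcases lt_or_gt_of_ne hij with hlt | hlt
    · exact lineSet_ne_of_resCount_ne_zero hlt (hpos j)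
    · exact (lineSet_ne_of_resCount_ne_zero hlt (hpos i)).symm
  · obtain ⟨c, -, hp⟩ := h.exists_isFund hD hg
    refine ⟨_, hp, c, ?_⟩
    have hprod : ∏ i, L i = l * m₁ * m₂ * g₁ * g₂ := Fin.prod_univ_five L
    rw [hprod]
    ring
  · have hmax : resCount (X : Set (ℝ × ℝ)) L s (L t) ≤ 5 :=
      (resCount_le _ _ _ _).trans (h5 _ (hline t).isLine)
    rcases hst.eq_or_lt with rfl | hlt
    · exact le_rfl
    fin_cases s
    · exact hmax.trans h0.ge
    · exact hmax.trans h1.ge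
    · exact hmax.trans h2.ge
    · obtain rfl : t = 4 := by
        ext
        have h3t : 3 < (t : ℕ) := hlt
        have := t.isLt
        change (t : ℕ) = 4
        omega
      exact ((hthree g₂).trans_le hle).trans h3.ge
    · exact absurd hlt (Fin.le_last t).not_gt

end Configuration

/-- in a `GC_5` set with no maximal line, if a line `l` is used by five
distinct nodes, then `l` is a 5-node line, it is used by exactly six nodes, these six nodes
form a `GC_2` set, they share two further common used lines with five primary nodes each,
and each of the six nodes has m-d sequence `(5,5,5,3,2)`. -/
theorem line_used_five_times (X : Set (ℝ × ℝ)) (hX : GCSet 5 X) (hnm : NoMaximalLine 5 X)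
    (l : MvPolynomial (Fin 2) ℝ) (hl : IsLinePoly l) (A1 A2 A3 A4 A5 : ℝ × ℝ)
    (h1 : A1 ∈ X) (h2 : A2 ∈ X) (h3 : A3 ∈ X) (h4 : A4 ∈ X) (h5 : A5 ∈ X)
    (h12 : A1 ≠ A2) (h13 : A1 ≠ A3) (h14 : A1 ≠ A4) (h15 : A1 ≠ A5)
    (h23 : A2 ≠ A3) (h24 : A2 ≠ A4) (h25 : A2 ≠ A5)
    (h34 : A3 ≠ A4) (h35 : A3 ≠ A5) (h45 : A4 ≠ A5)
    (hu1 : Uses 5 X A1 l) (hu2 : Uses 5 X A2 l) (hu3 : Uses 5 X A3 l)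
    (hu4 : Uses 5 X A4 l) (hu5 : Uses 5 X A5 l) :
    nodesOn X l = 5 ∧
    {D | D ∈ X ∧ Uses 5 X D l}.ncard = 6 ∧
    GCSet 2 {D | D ∈ X ∧ Uses 5 X D l} ∧
    (∃ m1 m2 : MvPolynomial (Fin 2) ℝ, IsLinePoly m1 ∧ IsLinePoly m2 ∧
      lineSet m1 ≠ lineSet m2 ∧ lineSet m1 ≠ lineSet l ∧ lineSet m2 ≠ lineSet l ∧
      (∀ P ∈ {D | D ∈ X ∧ Uses 5 X D l}, Uses 5 X P m1 ∧ Uses 5 X P m2) ∧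
      nodesOn X m1 = 5 ∧ nodesOn X m2 = 5 ∧
      Disjoint (X ∩ lineSet m1) (X ∩ lineSet m2) ∧
      Disjoint (X ∩ lineSet m1) (X ∩ lineSet l) ∧
      Disjoint (X ∩ lineSet m2) (X ∩ lineSet l)) ∧
    (∀ P ∈ {D | D ∈ X ∧ Uses 5 X D l}, HasMDSeq X P ![5, 5, 5, 3, 2]) := by
  classical
  lift X to Finset (ℝ × ℝ) using hX.1.1
  have hX21 : X.card = 21 := by rw [← Set.ncard_coe_finset, hX.1.2.1]
  have hnodes (m : MvPolynomial (Fin 2) ℝ) :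
      nodesOn (X : Set (ℝ × ℝ)) m = (X.filter (· ∈ lineSet m)).card := by
    rw [nodesOn, ← Set.ncard_coe_finset, Finset.coe_filter]
    rfl
  have hle5 : ∀ s, IsLine s → (X.filter (· ∈ s)).card ≤ 5 := by
    intro s hs
    have h6 := hX.card_filter_mem_le hs
    have hne := hnm _ hs.isLinePoly
    rw [hnodes, hs.lineSet_linePoly] at hne
    omega
  obtain ⟨S1, hS1⟩ := hX.exists_isStar h1 hl hu1
  obtain ⟨S2, hS2⟩ := hX.exists_isStar h2 hl hu2
  obtain ⟨S3, hS3⟩ := hX.exists_isStar h3 hl hu3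
  obtain ⟨S4, hS4⟩ := hX.exists_isStar h4 hl hu4
  obtain ⟨S5, hS5⟩ := hX.exists_isStar h5 hl hu5
  obtain ⟨x, y, hx, hy, hcard⟩ := exists_lines_of_isStar hX21 hle5 hl.isLine hS1 hS2 hS3 hS4 hS5
    (by simp [h12, h13, h14, h15, h23, h24, h25, h34, h35, h45])
  obtain ⟨m₁, hm₁, rfl⟩ := hx
  obtain ⟨m₂, hm₂, rfl⟩ := hy
  obtain ⟨R, hR⟩ : ∃ R, IsTriple X R l m₁ m₂ :=
    ⟨_, isTriple_of_card_le hX21 hle5 hl hm₁ hm₂ (by convert hcard)⟩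
  have hset : {D | D ∈ (X : Set (ℝ × ℝ)) ∧ Uses 5 (X : Set (ℝ × ℝ)) D l} = R := by
    ext D
    exact ⟨fun hD => hR.mem_of_uses hD.1 hD.2,
      fun hD => ⟨((hR.mem_rest D).1 hD).1, (hR.uses hX.1 hD).1⟩⟩
  have hcl := hR.card
  have hc₁ := hR.card₁
  have hc₂ := hR.card₂
  have hne {m m' : MvPolynomial (Fin 2) ℝ}
      (h : Disjoint ((X : Set (ℝ × ℝ)) ∩ lineSet m) ((X : Set (ℝ × ℝ)) ∩ lineSet m'))
      (hm : nodesOn (X : Set (ℝ × ℝ)) m = 5) : lineSet m ≠ lineSet m' := by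
    intro e
    rw [e, disjoint_self, Set.bot_eq_empty] at h
    rw [nodesOn, e, h, Set.ncard_empty] at hm
    omega
  have hd₁₂ : Disjoint ((X : Set (ℝ × ℝ)) ∩ lineSet m₁) ((X : Set (ℝ × ℝ)) ∩ lineSet m₂) :=
    Set.disjoint_left.2 fun P hP hP' => hR.notMem₁₂ P hP.1 hP.2 hP'.2
  have hd₁ : Disjoint ((X : Set (ℝ × ℝ)) ∩ lineSet m₁) ((X : Set (ℝ × ℝ)) ∩ lineSet l) :=
    Set.disjoint_left.2 fun P hP hP' => hR.notMem₁ P hP.1 hP'.2 hP.2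
  have hd₂ : Disjoint ((X : Set (ℝ × ℝ)) ∩ lineSet m₂) ((X : Set (ℝ × ℝ)) ∩ lineSet l) :=
    Set.disjoint_left.2 fun P hP hP' => hR.notMem₂ P hP.1 hP'.2 hP.2
  have hn₁ : nodesOn (X : Set (ℝ × ℝ)) m₁ = 5 := by
    rw [hnodes]
    convert hc₁
  have hn₂ : nodesOn (X : Set (ℝ × ℝ)) m₂ = 5 := by
    rw [hnodes]
    convert hc₂
  rw [hset]
  refine ⟨?_, ?_, hR.gcSet hX, ⟨m₁, m₂, hm₁, hm₂, hne hd₁₂ hn₁, hne hd₁ hn₁, hne hd₂ hn₂,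
    fun P hP => (hR.uses hX.1 hP).2, hn₁, hn₂, hd₁₂, hd₁, hd₂⟩, fun P hP => ?_⟩
  · rw [hnodes]
    convert hcl
  · rw [Set.ncard_coe_finset, hR.card_rest]
  · exact hR.hasMDSeq hX (fun s hs => by convert hle5 s hs) hP
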